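/- arXiv:2411.15389 — 2 statements merged into one kernel-verified Lean document; each statement's English description precedes it below -/
import Mathlib

section
/- Let S be a Gorenstein normal domain over k. Suppose M is a Cohen-Macaulay S-module containing S as a direct summand such that End_S(M) is a non-commutative resolution of S (i.e. M is reflexive and End_S(M) has finite global dimension). Then for every prime ideal p of S, the localization M_p is a generator of the stable category \underline{CM}(S_p): every object X of \underline{CM}(S_p) with Hom(M_p, X[i]) = 0 for all integers i is isomorphic to 0. -/
noncomputable section
attribute [local instance] Classical.propDecidable

open MvPolynomial CategoryTheory

/-- A Noetherian local ring is *regular* if its maximal ideal can be generated by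
`d` elements, where `d` is its Krull dimension. -/
def IsRegularLocal (R : Type) [CommRing R] [IsLocalRing R] : Prop :=
  IsNoetherianRing R ∧
    ∃ s : Finset R, Ideal.span (s : Set R) = IsLocalRing.maximalIdeal R ∧
      (s.card : WithBot (WithTop ℕ)) = ringKrullDim R

/-- The singular locus of `Spec S`: the set of primes `p` such that `S_p` is not regular. -/
def singularSet (S : Type) [CommRing S] : Set (PrimeSpectrum S) :=
  {p | ¬ IsRegularLocal (Localization.AtPrime p.asIdeal)}

/-- The depth of a module over a Noetherian local ring: the supremum of the lengths of
`M`-regular sequences contained in the maximal ideal, with the convention that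
`depth M = ∞` when `𝔪 • M = M`. -/
def moduleDepth (R : Type) [CommRing R] [IsLocalRing R]
    (M : Type) [AddCommGroup M] [Module R M] : WithBot (WithTop ℕ) :=
  if (IsLocalRing.maximalIdeal R) • (⊤ : Submodule R M) = ⊤ then (⊤ : WithTop ℕ)
  else sSup {d : WithBot (WithTop ℕ) | ∃ rs : List R,
    (∀ r ∈ rs, r ∈ IsLocalRing.maximalIdeal R) ∧
      RingTheory.Sequence.IsRegular M rs ∧ d = rs.length}

/-- A finitely generated module `M` over a commutative Noetherian ring `S` of Krull
dimension `d` is *(maximal) Cohen-Macaulay* if `depth (M_𝔪) = d` for every maximal ideal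
`𝔪` of `S`, or `M ≅ 0`. -/
def IsMCM (S : Type) [CommRing S] (M : Type) [AddCommGroup M] [Module S M] : Prop :=
  Subsingleton M ∨ ∀ (m : Ideal S) (hm : m.IsMaximal),
    letI := hm.isPrime
    moduleDepth (Localization.AtPrime m) (LocalizedModule m.primeCompl M) = ringKrullDim S

/-- A linear map factors through a finitely generated projective module
(equivalently, through an object of `add S`). -/
def FactorsThroughProj (S : Type) [CommRing S] {X Y : Type}
    [AddCommGroup X] [Module S X] [AddCommGroup Y] [Module S Y] (f : X →ₗ[S] Y) : Prop :=
  ∃ (P : ModuleCat.{0} S) (g : X →ₗ[S] P) (h : P →ₗ[S] Y),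
    Module.Finite S P ∧ Module.Projective S P ∧ h.comp g = f

/-- The two-sided ideal `[S] ⊆ End_S(M)` of endomorphisms factoring through
a finitely generated projective module. -/
def stabIdeal (S : Type) [CommRing S] (M : Type) [AddCommGroup M] [Module S M] :
    TwoSidedIdeal (Module.End S M) :=
  TwoSidedIdeal.span {f | FactorsThroughProj S f}

/-- The stable endomorphism algebra `End_{CM-bar(S)}(M) = End_S(M)/[S]`,
i.e. the contraction algebra `Λ^M_con`. -/
def StEnd (S : Type) [CommRing S] (M : Type) [AddCommGroup M] [Module S M] : Type :=
  (stabIdeal S M).ringCon.Quotient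

instance (S : Type) [CommRing S] (M : Type) [AddCommGroup M] [Module S M] :
    Ring (StEnd S M) :=
  inferInstanceAs (Ring (stabIdeal S M).ringCon.Quotient)

/-- The reduced ring of the center of a (possibly noncommutative) ring. -/
def RedCenter (A : Type) [Ring A] : Type :=
  (Subring.center A) ⧸ nilradical (Subring.center A)

instance (A : Type) [Ring A] : CommRing (RedCenter A) :=
  inferInstanceAs (CommRing ((Subring.center A) ⧸ nilradical (Subring.center A)))

/-- A commutative Noetherian ring `S` is *Gorenstein* if for every prime ideal `p` of `S`,
writing `S_p` for the localization, `𝔪` for its maximal ideal and `d` for its Krull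
dimension, one has `Ext^i_{S_p}(S_p/𝔪, S_p) = 0` for `i ≠ d` and
`Ext^d_{S_p}(S_p/𝔪, S_p) ≅ S_p/𝔪` (one-dimensional over the residue field). -/
def IsGorenstein (S : Type) [CommRing S] : Prop :=
  ∀ p : PrimeSpectrum S, ∀ i : ℕ,
    (((i : WithBot (WithTop ℕ)) ≠ ringKrullDim (Localization.AtPrime p.asIdeal)) →
      Subsingleton
        (((Ext (Localization.AtPrime p.asIdeal)
            (ModuleCat.{0} (Localization.AtPrime p.asIdeal)) i).obj
          (Opposite.op (ModuleCat.of (Localization.AtPrime p.asIdeal)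
            (IsLocalRing.ResidueField (Localization.AtPrime p.asIdeal))))).obj
          (ModuleCat.of (Localization.AtPrime p.asIdeal)
            (Localization.AtPrime p.asIdeal))))
    ∧ (((i : WithBot (WithTop ℕ)) = ringKrullDim (Localization.AtPrime p.asIdeal)) →
      Nonempty
        ((((Ext (Localization.AtPrime p.asIdeal)
            (ModuleCat.{0} (Localization.AtPrime p.asIdeal)) i).obj
          (Opposite.op (ModuleCat.of (Localization.AtPrime p.asIdeal)
            (IsLocalRing.ResidueField (Localization.AtPrime p.asIdeal))))).obj
          (ModuleCat.of (Localization.AtPrime p.asIdeal)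
            (Localization.AtPrime p.asIdeal)))
          ≃ₗ[Localization.AtPrime p.asIdeal]
            IsLocalRing.ResidueField (Localization.AtPrime p.asIdeal)))

/-- `X'` is a (first) syzygy of `X`: the kernel of a surjection onto `X` from a free
module. -/
def IsSyzygyOf (A : Type) [Ring A] (X' X : ModuleCat.{0} A) : Prop :=
  ∃ (ι : Type) (f : (ι →₀ A) →ₗ[A] X),
    Function.Surjective f ∧ Nonempty (X' ≃ₗ[A] LinearMap.ker f)

/-- `X'` is a `j`-th syzygy `Ω^j X` of `X`. -/
def IsSyzygyIter (A : Type) [Ring A] : ℕ → ModuleCat.{0} A → ModuleCat.{0} A → Prop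
  | 0, X', X => Nonempty (X' ≃ₗ[A] X)
  | (j+1), X', X => ∃ Z : ModuleCat.{0} A, IsSyzygyOf A Z X ∧ IsSyzygyIter A j X' Z

/-- A ring has global dimension `≤ d` when every `d`-th syzygy of any module is
projective. -/
def HasGlobalDimLE (A : Type) [Ring A] (d : ℕ) : Prop :=
  ∀ (X P : ModuleCat.{0} A), IsSyzygyIter A d P X → Module.Projective A P

/-- A ring has finite global dimension. -/
def HasFiniteGlobalDim (A : Type) [Ring A] : Prop :=
  ∃ d : ℕ, HasGlobalDimLE A d


/-- Every stable homomorphism `A → B` vanishes in the stable category of Cohen-Macaulay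
modules, i.e. every linear map `A → B` factors through a finitely generated projective. -/
def StHomTrivial (S : Type) [CommRing S] (A B : Type)
    [AddCommGroup A] [Module S A] [AddCommGroup B] [Module S B] : Prop :=
  ∀ f : A →ₗ[S] B, FactorsThroughProj S f

set_option linter.unusedSectionVars false

section partA
open CategoryTheory.Abelian

/-- vanishing of Ext from the residue field below t -/
def ExtVan (R : Type) [CommRing R] [IsLocalRing R] (t : ℕ) (W : Type)
    [AddCommGroup W] [Module R W] : Prop :=
  ∀ i < t, Subsingleton (Abelian.Ext (ModuleCat.of R (IsLocalRing.ResidueField R))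
    (ModuleCat.of R W) i)

variable (R : Type) [CommRing R] [IsLocalRing R]

lemma supp_resfield : Module.support R (ModuleCat.of R (IsLocalRing.ResidueField R)) =
    PrimeSpectrum.zeroLocus (IsLocalRing.maximalIdeal R) := by
  have : Module.support R (R ⧸ IsLocalRing.maximalIdeal R) =
    PrimeSpectrum.zeroLocus (IsLocalRing.maximalIdeal R) := by
    rw [Module.support_eq_zeroLocus, Ideal.annihilator_quotient]
  exact this

lemma depth_key [IsNoetherianRing R] : ∀ n : ℕ, ExtVan R n R → (n : WithBot ℕ∞) ≤ ringKrullDim R := by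
    intro n hn
    obtain ⟨rs, hl, hm, hr⟩ := ModuleCat.exists_isRegular_of_exists_subsingleton_ext
      (IsLocalRing.maximalIdeal R) n (ModuleCat.of R R)
      (by
        rw [lt_top_iff_ne_top]
        simpa using Ideal.IsPrime.ne_top' (I := IsLocalRing.maximalIdeal R))
      (ModuleCat.of R (IsLocalRing.ResidueField R)) (supp_resfield R) hn
    have h := ringKrullDim_add_length_eq_ringKrullDim_of_isRegular rs hr
    have : Nontrivial (R ⧸ Ideal.ofList rs) := by
      apply Ideal.Quotient.nontrivial_iff.mpr
      intro h1
      have : Ideal.ofList rs ≤ IsLocalRing.maximalIdeal R := by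
        rw [Ideal.ofList, Ideal.span_le]; exact hm
      exact Ideal.IsPrime.ne_top' (I := IsLocalRing.maximalIdeal R) (top_le_iff.mp (h1 ▸ this))
    rw [← h, hl]
    have h0 : (0 : WithBot ℕ∞) ≤ ringKrullDim (R ⧸ Ideal.ofList rs) := ringKrullDim_nonneg_of_nontrivial
    calc (n : WithBot ℕ∞) = 0 + n := by simp
      _ ≤ _ := by gcongr

lemma exists_dim [IsNoetherianRing R] : ∃ d : ℕ, ringKrullDim R = d := by
  have hfin : ringKrullDim R < ⊤ := ringKrullDim_lt_top
  have h0 : (0 : WithBot ℕ∞) ≤ ringKrullDim R := ringKrullDim_nonneg_of_nontrivial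
  generalize ringKrullDim R = y at *
  lift y to ℕ∞ using (by intro h; rw [h] at h0; exact absurd h0 (by simp))
  lift y to ℕ using (by rintro rfl; exact absurd hfin (by simp))
  exact ⟨y, rfl⟩

lemma exists_depth [IsNoetherianRing R] : ∃ t : ℕ, ExtVan R t R ∧
    ¬ Subsingleton (Abelian.Ext (ModuleCat.of R (IsLocalRing.ResidueField R))
      (ModuleCat.of R R) t) ∧ (t : WithBot (WithTop ℕ)) ≤ ringKrullDim R := by
  have key := depth_key R
  have hex : ∃ t : ℕ, ¬ Subsingleton (Abelian.Ext (ModuleCat.of R (IsLocalRing.ResidueField R))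
      (ModuleCat.of R R) t) := by
    by_contra hc
    push Not at hc
    have hfin : ringKrullDim R < ⊤ := ringKrullDim_lt_top
    have h0 : (0 : WithBot ℕ∞) ≤ ringKrullDim R := ringKrullDim_nonneg_of_nontrivial
    obtain ⟨d, hd⟩ := exists_dim R
    have hk := key (d+1) (fun i _ => hc i)
    rw [hd] at hk
    have h2 : d + 1 ≤ d := by exact_mod_cast hk
    omega
  refine ⟨Nat.find hex, ?_, Nat.find_spec hex, ?_⟩
  · intro i hi; simpa using Nat.find_min hex hi
  · apply key; intro i hi; simpa using Nat.find_min hex hi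

variable {R}

lemma extVan_of_regular [IsNoetherianRing R] (X : Type) [AddCommGroup X] [Module R X]
    [Module.Finite R X] [Nontrivial X] (rs : List R)
    (mem : ∀ r ∈ rs, r ∈ IsLocalRing.maximalIdeal R) (reg : RingTheory.Sequence.IsRegular X rs)
    (t : ℕ) (ht : t ≤ rs.length) : ExtVan R t X := by
  intro i hi
  refine ModuleCat.subsingleton_ext_of_exists_isRegular (IsLocalRing.maximalIdeal R)
    (ModuleCat.of R (IsLocalRing.ResidueField R)) (supp_resfield R).subset (ModuleCat.of R X)
    ?_ rs mem reg i (by omega)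
  rw [lt_top_iff_ne_top]
  intro h
  have := Submodule.eq_bot_of_le_smul_of_le_jacobson_bot (IsLocalRing.maximalIdeal R)
    (⊤ : Submodule R X) Module.Finite.fg_top h.ge (IsLocalRing.maximalIdeal_le_jacobson _)
  exact top_ne_bot this

/-- extension class from free rank one -/
lemma extVan_pi (t a : ℕ) (h : ExtVan R t R) : ExtVan R t (Fin a → R) := by
  intro i hi
  have := h i hi
  refine subsingleton_of_forall_eq 0 fun x => ?_
  have hid : 𝟙 (ModuleCat.of R (Fin a → R)) = ∑ j : Fin a,
      ModuleCat.ofHom (LinearMap.proj j : (Fin a → R) →ₗ[R] R) ≫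
      ModuleCat.ofHom (LinearMap.single R (fun _ : Fin a => R) j) := by
    ext v k
    simp [ModuleCat.hom_sum, Pi.single_apply]
  have h1 : x = x.comp (Abelian.Ext.mk₀ (𝟙 (ModuleCat.of R (Fin a → R)))) (add_zero _) := by simp
  rw [h1, hid, Abelian.Ext.mk₀_sum, Abelian.Ext.comp_sum]
  refine Finset.sum_eq_zero fun j _ => ?_
  rw [← Abelian.Ext.mk₀_comp_mk₀, ← Abelian.Ext.comp_assoc_of_third_deg_zero]
  rw [Subsingleton.elim (x.comp _ _) 0, Abelian.Ext.zero_comp]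

lemma kill (x : R) (hx : x ∈ IsLocalRing.maximalIdeal R) (W : ModuleCat.{0} R) (n : ℕ)
    (y : Abelian.Ext (ModuleCat.of R (IsLocalRing.ResidueField R)) W n) : x • y = 0 := by
  have := Abelian.Ext.postcomp_smul_id_eq_zero_of_mem_annihilator (R := R) (M := W)
    (N := ModuleCat.of R (IsLocalRing.ResidueField R)) (r := x) (by
      change x ∈ Module.annihilator R (R ⧸ IsLocalRing.maximalIdeal R)
      rwa [Ideal.annihilator_quotient]) n
  have h2 := congrArg (fun f => f.hom y) this
  rw [Abelian.Ext.smul_eq_comp_mk₀]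
  simpa using h2

/-- short exact sequence from a map h : F → Y: ker → F → range -/
lemma ses_shortExact {F Y : Type} [AddCommGroup F] [Module R F] [AddCommGroup Y] [Module R Y]
    (h : F →ₗ[R] Y) : (ShortComplex.mk (ModuleCat.ofHom (LinearMap.ker h).subtype)
      (ModuleCat.ofHom h.rangeRestrict) (by ext x; simp)).ShortExact where
  exact := by
    rw [ShortComplex.moduleCat_exact_iff]
    intro x hx
    refine ⟨⟨x, ?_⟩, rfl⟩
    have := congrArg Subtype.val hx
    exact this
  mono_f := (ModuleCat.mono_iff_injective _).mpr Subtype.val_injective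
  epi_g := (ModuleCat.epi_iff_surjective _).mpr h.surjective_rangeRestrict

lemma extVan_ker {F Y : Type} [AddCommGroup F] [Module R F] [AddCommGroup Y] [Module R Y]
    (h : F →ₗ[R] Y) (t : ℕ) (hF : ExtVan R t F) (hY : ExtVan R t (LinearMap.range h)) :
    ExtVan R t (LinearMap.ker h) := by
  intro i hi
  refine subsingleton_of_forall_eq 0 fun x => ?_
  have hses := ses_shortExact h
  have hFi := hF i hi
  cases i with
  | zero =>
    apply Abelian.Ext.postcomp_mk₀_injective_of_mono _ (ModuleCat.ofHom (LinearMap.ker h).subtype)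
      (hf := hses.mono_f)
    exact Subsingleton.elim _ _
  | succ i =>
    have := hY i (by omega)
    obtain ⟨y, hy⟩ := Abelian.Ext.covariant_sequence_exact₁ _ hses x
      (Subsingleton.elim (α := Abelian.Ext (ModuleCat.of R (IsLocalRing.ResidueField R))
    (ModuleCat.of R F) (i+1)) _ _) rfl
    rw [← hy, Subsingleton.elim (α := Abelian.Ext (ModuleCat.of R (IsLocalRing.ResidueField R))
    (ModuleCat.of R (LinearMap.range h)) i) y 0, Abelian.Ext.zero_comp]

lemma free_ker_zero {a b : ℕ} {Y : Type} [AddCommGroup Y] [Module R Y]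
    (h : (Fin a → R) →ₗ[R] Y) (g : (Fin b → R) →ₗ[R] (Fin a → R))
    (hg : Function.Injective g) (hgh : LinearMap.range g = LinearMap.ker h)
    (hm : ∀ x i, g x i ∈ IsLocalRing.maximalIdeal R) (t : ℕ)
    (hY : ExtVan R t (LinearMap.range h))
    (ht : ¬ Subsingleton (Abelian.Ext (ModuleCat.of R (IsLocalRing.ResidueField R))
      (ModuleCat.of R R) t)) : b = 0 := by
  by_contra hb
  apply ht
  let j0 : Fin b := ⟨0, by omega⟩
  refine subsingleton_of_forall_eq 0 fun x => ?_
  have hses := ses_shortExact h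
  let e : (Fin b → R) ≃ₗ[R] LinearMap.ker h :=
    (LinearEquiv.ofInjective g hg).trans (LinearEquiv.ofEq _ _ hgh)
  let s : ModuleCat.of R R ⟶ ModuleCat.of R (LinearMap.ker h) :=
    ModuleCat.ofHom (e.toLinearMap.comp (LinearMap.single R (fun _ : Fin b => R) j0))
  let r : ModuleCat.of R (LinearMap.ker h) ⟶ ModuleCat.of R R :=
    ModuleCat.ofHom ((LinearMap.proj j0).comp e.symm.toLinearMap)
  have hsr : s ≫ r = 𝟙 _ := by
    ext
    simp [s, r]
  let y := x.comp (Abelian.Ext.mk₀ s) (add_zero t)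
  have hy0 : y.comp (Abelian.Ext.mk₀ (ModuleCat.ofHom (LinearMap.ker h).subtype)) (add_zero t) = 0 := by
    have hs : s ≫ ModuleCat.ofHom (LinearMap.ker h).subtype = ∑ i : Fin a,
        (g (Pi.single j0 1) i) • ModuleCat.ofHom (LinearMap.single R (fun _ : Fin a => R) i) := by
      ext k
      simp [ModuleCat.hom_sum, ModuleCat.hom_smul, s, e, Pi.single_apply]
    simp only [y]
    rw [Abelian.Ext.comp_assoc_of_third_deg_zero, Abelian.Ext.mk₀_comp_mk₀, hs,
      Abelian.Ext.mk₀_sum, Abelian.Ext.comp_sum]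
    refine Finset.sum_eq_zero fun i _ => ?_
    rw [Abelian.Ext.mk₀_smul, Abelian.Ext.comp_smul]
    exact kill _ (hm _ _) _ _ _
  have hy : y = 0 := by
    clear_value y
    cases t with
    | zero =>
      apply Abelian.Ext.postcomp_mk₀_injective_of_mono _ (ModuleCat.ofHom (LinearMap.ker h).subtype)
        (hf := hses.mono_f)
      simpa using hy0
    | succ t =>
      have := hY t (by omega)
      obtain ⟨z, hz⟩ := Abelian.Ext.covariant_sequence_exact₁ _ hses y hy0 rfl
      rw [← hz, Subsingleton.elim (α := Abelian.Ext (ModuleCat.of R (IsLocalRing.ResidueField R))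
      (ModuleCat.of R (LinearMap.range h)) t) z 0, Abelian.Ext.zero_comp]
  have : x = y.comp (Abelian.Ext.mk₀ r) (add_zero t) := by
    simp only [y]
    rw [Abelian.Ext.comp_assoc_of_third_deg_zero, Abelian.Ext.mk₀_comp_mk₀, hsr]
    simp
  rw [this, hy, Abelian.Ext.zero_comp]

end partA
section partB

/-- minimal cover -/
lemma exists_min_cover {R : Type} [CommRing R] [IsLocalRing R] (K : Type) [AddCommGroup K]
    [Module R K] [Module.Finite R K] : ∃ (a : ℕ) (v : Fin a → K),
      Submodule.span R (Set.range v) = ⊤ ∧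
      ∀ x : Fin a → R, ∑ i, x i • v i = 0 → ∀ i, x i ∈ IsLocalRing.maximalIdeal R := by
  let b := Module.finBasis (IsLocalRing.ResidueField R)
    (TensorProduct R (IsLocalRing.ResidueField R) K)
  obtain ⟨v, hv⟩ := (TensorProduct.mk_surjective R K (IsLocalRing.ResidueField R)
    Ideal.Quotient.mk_surjective).comp_left b
  refine ⟨_, v, IsLocalRing.span_eq_top_of_tmul_eq_basis v b (congrFun hv), ?_⟩
  intro x hx i
  have h1 : ∑ i, (IsLocalRing.residue R (x i)) • b i = 0 := by
    rw [← hv]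
    have := congrArg (TensorProduct.mk R (IsLocalRing.ResidueField R) K 1) hx
    rw [map_sum, map_zero] at this
    rw [← this]
    refine Finset.sum_congr rfl fun j _ => ?_
    rw [map_smul]
    rfl
  have h2 := Fintype.linearIndependent_iff.mp b.linearIndependent _ h1 i
  exact (IsLocalRing.residue_eq_zero_iff _).mp h2

variable {S : Type} [CommRing S] (p : Ideal S) [p.IsPrime]

/-- the localized matrix as a linear map -/
def locMat {c a : ℕ} (A : Matrix (Fin c) (Fin a) S) :
    (Fin a → Localization.AtPrime p) →ₗ[Localization.AtPrime p] (Fin c → Localization.AtPrime p) :=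
  (A.map (algebraMap S (Localization.AtPrime p))).mulVecLin

lemma locMat_apply {c a : ℕ} (A : Matrix (Fin c) (Fin a) S) (x : Fin a → Localization.AtPrime p)
    (i : Fin c) : locMat p A x i = ∑ j, algebraMap S (Localization.AtPrime p) (A i j) * x j := by
  simp [locMat, Matrix.mulVec, dotProduct]

lemma exists_step [IsNoetherianRing S] (c : ℕ)
    (K : Submodule (Localization.AtPrime p) (Fin c → Localization.AtPrime p))
    (hK : ∀ x ∈ K, ∀ i, x i ∈ IsLocalRing.maximalIdeal (Localization.AtPrime p)) :
    ∃ (a : ℕ) (A : Matrix (Fin c) (Fin a) S), (∀ i j, A i j ∈ p) ∧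
      LinearMap.range (locMat p A) = K ∧
      ∀ x ∈ LinearMap.ker (locMat p A), ∀ i,
        x i ∈ IsLocalRing.maximalIdeal (Localization.AtPrime p) := by
  have : IsNoetherianRing (Localization.AtPrime p) :=
    IsLocalization.isNoetherianRing p.primeCompl _ inferInstance
  obtain ⟨a, v, hv, hmin⟩ := exists_min_cover (R := Localization.AtPrime p) K
  obtain ⟨s, hs⟩ := IsLocalization.exist_integer_multiples_of_finite p.primeCompl
    (fun q : Fin c × Fin a => (v q.2 : Fin c → Localization.AtPrime p) q.1)
  choose B hB using hs
  let A : Matrix (Fin c) (Fin a) S := fun i j => B (i, j)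
  have hA : ∀ i j, algebraMap S (Localization.AtPrime p) (A i j) =
      algebraMap S (Localization.AtPrime p) s * (v j : Fin c → Localization.AtPrime p) i := by
    intro i j
    rw [hB (i,j), Algebra.smul_def]
  have hu : IsUnit (algebraMap S (Localization.AtPrime p) s) := IsLocalization.map_units _ s
  have happ : ∀ x, locMat p A x = algebraMap S (Localization.AtPrime p) s •
      ((∑ j, x j • v j : K) : Fin c → Localization.AtPrime p) := by
    intro x
    funext i
    rw [locMat_apply]
    simp only [hA, Pi.smul_apply, smul_eq_mul, Submodule.coe_sum, Finset.sum_apply,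
      Submodule.coe_smul, Finset.mul_sum]
    exact Finset.sum_congr rfl fun j _ => by ring
  refine ⟨a, A, ?_, ?_, ?_⟩
  · intro i j
    have := (IsLocalization.AtPrime.to_map_mem_maximal_iff (Localization.AtPrime p) p (A i j)).mp
    apply this
    rw [hA]
    exact Ideal.mul_mem_left _ _ (hK _ (v j).2 i)
  · apply le_antisymm
    · rintro _ ⟨x, rfl⟩
      rw [happ]
      exact K.smul_mem _ (Subtype.mem _)
    · intro y hy
      obtain ⟨u, hu'⟩ := hu
      have : (⟨y, hy⟩ : K) ∈ Submodule.span (Localization.AtPrime p) (Set.range v) := by rw [hv]; trivial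
      obtain ⟨x, hx⟩ := (Submodule.mem_span_range_iff_exists_fun _).mp this
      refine ⟨fun j => (↑u⁻¹ : Localization.AtPrime p) * x j, ?_⟩
      rw [happ]
      have h3 : (∑ j, ((↑u⁻¹ : Localization.AtPrime p) * x j) • v j) = (↑u⁻¹ : Localization.AtPrime p) • (⟨y, hy⟩ : K) := by
        rw [← hx, Finset.smul_sum]
        exact Finset.sum_congr rfl fun j _ => by rw [mul_smul]
      rw [h3, ← hu']
      simp [smul_smul]
  · intro x hx i
    apply hmin x
    have h1 : locMat p A x = 0 := hx
    rw [happ] at h1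
    have := hu.smul_eq_zero.mp h1
    exact Subtype.ext this

/-- minimal resolution -/
lemma exists_resolution [IsNoetherianRing S] (X : Type) [AddCommGroup X]
    [Module (Localization.AtPrime p) X] [Module.Finite (Localization.AtPrime p) X] :
    ∃ (a : ℕ → ℕ) (A : (n : ℕ) → Matrix (Fin (a n)) (Fin (a (n+1))) S)
      (f : (Fin (a 0) → Localization.AtPrime p) →ₗ[Localization.AtPrime p] X),
      (∀ n i j, A n i j ∈ p) ∧ Function.Surjective f ∧
      LinearMap.range (locMat p (A 0)) = LinearMap.ker f ∧
      ∀ n, LinearMap.range (locMat p (A (n+1))) = LinearMap.ker (locMat p (A n)) := by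
  obtain ⟨a0, v, hv, hmin⟩ := exists_min_cover (R := Localization.AtPrime p) X
  let f := Fintype.linearCombination (Localization.AtPrime p) v
  let T := Σ c : ℕ, {K : Submodule (Localization.AtPrime p) (Fin c → Localization.AtPrime p) //
    ∀ x ∈ K, ∀ i, x i ∈ IsLocalRing.maximalIdeal (Localization.AtPrime p)}
  choose nxt mat h1 h2 h3 using fun t : T => exists_step p t.1 t.2.1 t.2.2
  let step : T → T := fun t => ⟨nxt t, ⟨LinearMap.ker (locMat p (mat t)), h3 t⟩⟩
  let t0 : T := ⟨a0, ⟨LinearMap.ker f, fun x hx => hmin x (by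
    simpa [f, Fintype.linearCombination_apply] using hx)⟩⟩
  let st : ℕ → T := fun n => Nat.rec t0 (fun _ t => step t) n
  refine ⟨fun n => (st n).1, fun n => mat (st n), f, fun n => h1 (st n), ?_, h2 t0, ?_⟩
  · rw [← LinearMap.range_eq_top, Fintype.range_linearCombination, hv]
  · intro n
    exact h2 (st (n+1))

end partB

section partD

lemma mcm_regular {R : Type} [CommRing R] [IsLocalRing R] [IsNoetherianRing R] (X : Type)
    [AddCommGroup X] [Module R X] [Module.Finite R X] [Nontrivial X] (h : IsMCM R X)
    (t : ℕ) (ht : (t : WithBot (WithTop ℕ)) ≤ ringKrullDim R) :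
    ExtVan R t X := by
  cases t with
  | zero => intro i hi; omega
  | succ t =>
  rcases h with h | h
  · exact absurd h (not_subsingleton X)
  have h := h (IsLocalRing.maximalIdeal R) inferInstance
  simp only [moduleDepth] at h
  split_ifs at h with hc
  · exfalso
    have := ringKrullDim_lt_top (R := R)
    rw [← h] at this
    exact lt_irrefl _ this
  have hlt : ((t : ℕ) : WithBot (WithTop ℕ)) < ringKrullDim R :=
    lt_of_lt_of_le (by
      change ((t : ℕ) : WithBot ℕ∞) < ((t + 1 : ℕ) : WithBot ℕ∞)
      exact_mod_cast Nat.lt_succ_self t) ht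
  rw [← h] at hlt
  obtain ⟨d, ⟨rs, hmem, hreg, rfl⟩, hd⟩ := lt_sSup_iff.mp hlt
  have hlen : t + 1 ≤ rs.length := by
    have hd' : ((t : ℕ) : WithBot ℕ∞) < ((rs.length : ℕ) : WithBot ℕ∞) := hd
    exact_mod_cast hd'
  have hunits : ∀ x : (IsLocalRing.maximalIdeal R).primeCompl, IsUnit (x : R) := by
    intro x
    by_contra hx
    exact x.2 hx
  let σ : R ≃ₐ[R] Localization.AtPrime (IsLocalRing.maximalIdeal R) :=
    IsLocalization.atUnits R (IsLocalRing.maximalIdeal R).primeCompl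
      (fun x hx => hunits ⟨x, hx⟩)
  let e : X ≃ₗ[R] LocalizedModule (IsLocalRing.maximalIdeal R).primeCompl X :=
    LinearEquiv.ofBijective (LocalizedModule.mkLinearMap _ X) (by
      constructor
      · intro x y hxy
        obtain ⟨c, hc⟩ := (IsLocalizedModule.eq_iff_exists
          (IsLocalRing.maximalIdeal R).primeCompl (LocalizedModule.mkLinearMap _ X)).mp hxy
        exact (hunits c).smul_left_cancel.mp hc
      · intro y
        obtain ⟨⟨x, s⟩, hx⟩ := IsLocalizedModule.surj
          (IsLocalRing.maximalIdeal R).primeCompl (LocalizedModule.mkLinearMap _ X) y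
        obtain ⟨u, hu⟩ := hunits s
        refine ⟨(↑u⁻¹ : R) • x, ?_⟩
        rw [map_smul, ← hx]
        change (↑u⁻¹ : R) • (s : R) • y = y
        rw [smul_smul, ← hu]
        simp)
  have hσ : ∀ r : Localization.AtPrime (IsLocalRing.maximalIdeal R),
      algebraMap R _ (σ.symm r) = r := by
    intro r
    rw [← σ.commutes, Algebra.algebraMap_self_apply, σ.apply_symm_apply]
  have hreg' : RingTheory.Sequence.IsRegular X (rs.map σ.symm) := by
    refine (AddEquiv.isRegular_congr (e := e.toAddEquiv) (bs := rs) ?_).mpr hreg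
    rw [List.forall₂_map_left_iff]
    refine List.forall₂_same.mpr fun r _ x => ?_
    change e (σ.symm r • x) = r • e x
    rw [map_smul, ← algebraMap_smul (Localization.AtPrime (IsLocalRing.maximalIdeal R)), hσ]
  refine extVan_of_regular X (rs.map σ.symm) ?_ hreg' _ (by simpa using hlen)
  intro r hr
  obtain ⟨r', hr', rfl⟩ := List.mem_map.mp hr
  rw [IsLocalRing.mem_maximalIdeal, mem_nonunits_iff]
  intro hu
  have := hu.map (algebraMap R (Localization.AtPrime (IsLocalRing.maximalIdeal R)))
  rw [hσ] at this
  exact (IsLocalRing.mem_maximalIdeal _).mp (hmem r' hr') this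

end partD

section PartC
variable {S : Type} [CommRing S] {Λ : Type} [Ring Λ] [Algebra S Λ]

/-- Exactness up to denominators outside `p`. -/
def VProp (p : Ideal S) (e : Λ) (a : ℕ → ℕ) (A : ∀ n, Matrix (Fin (a n)) (Fin (a (n+1))) S)
    (n : ℕ) (Z : Type) [AddCommGroup Z] [Module Λ Z] [Module S Z] : Prop :=
  ∀ w : Fin (a (n+1)) → Z, (∀ j, e • w j = w j) → (∀ i, ∑ j, A n i j • w j = 0) →
    ∃ s, s ∉ p ∧ ∃ w' : Fin (a (n+2)) → Z, ∀ j, s • w j = ∑ l, A (n+1) j l • w' l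

variable (p : Ideal S) [p.IsPrime] (e : Λ) (a : ℕ → ℕ)
  (A : ∀ n, Matrix (Fin (a n)) (Fin (a (n+1))) S)

lemma vProp_finsupp (n : ℕ) (h : VProp p e a A n Λ) (I : Type) : VProp p e a A n (I →₀ Λ) := by
  intro w he hA
  have h1 : ∀ c : I, ∃ s, s ∉ p ∧ ∃ w' : Fin (a (n+2)) → Λ,
      ∀ j, s • w j c = ∑ l, A (n+1) j l • w' l := by
    intro c
    refine h (fun j => w j c) (fun j => ?_) (fun i => ?_)
    · have := DFunLike.congr_fun (he j) c
      simpa using this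
    · have := DFunLike.congr_fun (hA i) c
      simpa [Finsupp.finsetSum_apply] using this
  choose s hs w' hw' using h1
  let T : Finset I := Finset.univ.biUnion (fun j => (w j).support)
  refine ⟨∏ c ∈ T, s c, ?_, fun l => Finsupp.indicator T
    (fun c _ => (∏ d ∈ T.erase c, s d) • w' c l), fun j => ?_⟩
  · intro hmem
    obtain ⟨c, -, hc⟩ := (Ideal.IsPrime.prod_mem_iff (p := p)).1 hmem
    exact hs c hc
  · ext c
    rw [Finsupp.finsetSum_apply]
    by_cases hc : c ∈ T
    · have : ∏ c ∈ T, s c = (∏ d ∈ T.erase c, s d) * s c := by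
        rw [mul_comm, Finset.mul_prod_erase _ _ hc]
      rw [this]
      simp only [Finsupp.smul_apply, Finsupp.indicator_of_mem hc, mul_smul, hw', Finset.smul_sum]
      refine Finset.sum_congr rfl fun l _ => ?_
      rw [smul_comm]
    · have h0 : w j c = 0 := by
        by_contra h0
        exact hc (Finset.mem_biUnion.2 ⟨j, Finset.mem_univ _, Finsupp.mem_support_iff.2 h0⟩)
      simp [Finsupp.indicator_of_notMem hc, h0]

lemma vProp_retract (n : ℕ) {P F : Type} [AddCommGroup P] [Module Λ P] [Module S P]
    [IsScalarTower S Λ P] [AddCommGroup F] [Module Λ F] [Module S F]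
    [IsScalarTower S Λ F] (i : P →ₗ[Λ] F) (r : F →ₗ[Λ] P) (hr : ∀ x, r (i x) = x)
    (h : VProp p e a A n F) : VProp p e a A n P := by
  intro w he hA
  obtain ⟨s, hs, w', hw'⟩ := h (fun j => i (w j)) (fun j => by rw [← map_smul, he])
    (fun k => by
      have := congrArg i (hA k)
      simpa [map_sum, LinearMap.map_smul_of_tower] using this)
  refine ⟨s, hs, fun l => r (w' l), fun j => ?_⟩
  have := congrArg r (hw' j)
  simpa [map_sum, LinearMap.map_smul_of_tower, hr] using this

lemma vProp_proj (n : ℕ) (h : VProp p e a A n Λ) (P : Type) [AddCommGroup P] [Module Λ P]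
    [Module S P] [IsScalarTower S Λ P] [hP : Module.Projective Λ P] : VProp p e a A n P := by
  obtain ⟨i, hi⟩ := Module.projective_def.1 hP
  exact vProp_retract p e a A n i (Finsupp.linearCombination Λ id) hi (vProp_finsupp p e a A n h P)

lemma vProp_shift (hee : e * e = e) (hAA : ∀ n, A n * A (n+1) = 0) (n : ℕ)
    {Z Q : Type} [AddCommGroup Z] [Module Λ Z] [Module S Z]
    [IsScalarTower S Λ Z] [AddCommGroup Q] [Module Λ Q] [Module S Q]
    [IsScalarTower S Λ Q] (q : Q →ₗ[Λ] Z) (hq : Function.Surjective q)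
    (h1 : VProp p e a A n (LinearMap.ker q)) (h2 : VProp p e a A (n+1) Q) :
    VProp p e a A (n+1) Z := by
  intro w he hA
  choose w0 hw0 using fun j => hq (w j)
  have hes : ∀ (s : S) (x : Q), e • s • x = s • e • x := fun s x => smul_comm e s x
  let y : Fin (a (n+1)) → Q := fun i => ∑ j, A (n+1) i j • e • w0 j
  have hy : ∀ i, y i ∈ LinearMap.ker q := by
    intro i
    rw [LinearMap.mem_ker, ← hA i]
    simp only [y, map_sum, LinearMap.map_smul_of_tower, map_smul, hw0, he]
  have hey : ∀ i, e • y i = y i := by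
    intro i
    simp only [y, Finset.smul_sum, hes, smul_smul, hee]
  obtain ⟨s, hs, u, hu⟩ := h1 (fun i => ⟨y i, hy i⟩) (fun i => Subtype.ext (hey i)) (fun i => by
    apply Subtype.ext
    simp only [Submodule.coe_sum, Submodule.coe_smul_of_tower, Submodule.coe_zero, y,
      Finset.smul_sum, smul_smul]
    rw [Finset.sum_comm]
    refine Finset.sum_eq_zero fun j _ => ?_
    rw [← Finset.sum_smul]
    have := congrFun (congrFun (hAA n) i) j
    rw [Matrix.mul_apply] at this
    rw [this]; simp)
  have hu' : ∀ i, s • y i = ∑ l, A (n+1) i l • (u l : Q) := by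
    intro i
    have := congrArg Subtype.val (hu i)
    simpa only [Submodule.coe_sum, Submodule.coe_smul_of_tower] using this
  obtain ⟨t, ht, v, hv⟩ := h2 (fun j => s • e • w0 j - e • (u j : Q)) (fun j => by
      rw [smul_sub, hes, smul_smul, smul_smul, hee]) (fun i => by
      simp only [smul_sub, Finset.sum_sub_distrib]
      have : ∑ l, A (n+1) i l • e • (u l : Q) = e • s • y i := by
        rw [hu', Finset.smul_sum]
        exact Finset.sum_congr rfl fun l _ => (hes _ _).symm
      rw [this, hes, hey]
      simp only [y, Finset.smul_sum]
      rw [sub_eq_zero]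
      exact Finset.sum_congr rfl fun l _ => smul_comm _ _ _)
  refine ⟨t * s, fun hm => ?_, fun l => q (v l), fun j => ?_⟩
  · rcases Ideal.IsPrime.mem_or_mem ‹_› hm with h | h
    exacts [ht h, hs h]
  · have := congrArg q (hv j)
    simp only [map_sum, LinearMap.map_smul_of_tower, map_smul, map_sub, hw0, he,
      LinearMap.mem_ker.1 (u j).2, smul_zero, sub_zero] at this
    rw [mul_smul, this]

lemma vProp_of_syz (hee : e * e = e) (hAA : ∀ n, A n * A (n+1) = 0)
    (hL : ∀ n, VProp p e a A n Λ) (d : ℕ) :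
    ∀ (Z : Type) [AddCommGroup Z] [Module Λ Z] [Module S Z] [IsScalarTower S Λ Z],
    (∀ P : ModuleCat.{0} Λ, IsSyzygyIter Λ d P (ModuleCat.of Λ Z) → Module.Projective Λ P) →
    ∀ n, d ≤ n → VProp p e a A n Z := by
  induction d with
  | zero =>
    intro Z _ _ _ _ h n _
    have : Module.Projective Λ Z := h (ModuleCat.of Λ Z) ⟨LinearEquiv.refl _ _⟩
    exact vProp_proj p e a A n (hL n) Z
  | succ d ih =>
    intro Z _ _ _ _ h n hn
    obtain ⟨n, rfl⟩ : ∃ m, n = m + 1 := ⟨n - 1, by omega⟩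
    have hsurj : Function.Surjective (Finsupp.linearCombination Λ (id : Z → Z)) :=
      fun z => ⟨Finsupp.single z 1, by simp⟩
    refine vProp_shift p e a A hee hAA n (Finsupp.linearCombination Λ (id : Z → Z)) hsurj ?_
      (vProp_finsupp p e a A (n+1) (hL (n+1)) Z)
    refine ih _ (fun P hP => h P ⟨_, ?_, hP⟩) n (by omega)
    exact ⟨Z, Finsupp.linearCombination Λ (id : Z → Z), hsurj, ⟨LinearEquiv.refl _ _⟩⟩

end PartC

section PartE
variable {S : Type} [CommRing S] (p : Ideal S) [p.IsPrime]

lemma syz_append {R : Type} [Ring R] (j : ℕ) : ∀ (X X' X'' : ModuleCat.{0} R),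
    IsSyzygyIter R j X' X → IsSyzygyOf R X'' X' → IsSyzygyIter R (j+1) X'' X := by
  induction j with
  | zero =>
    rintro X X' X'' ⟨e⟩ ⟨I, f, hf, ⟨e'⟩⟩
    have hk : LinearMap.ker f = LinearMap.ker (e.toLinearMap ∘ₗ f) := by
      ext x
      simp
    exact ⟨X'', ⟨I, e.toLinearMap ∘ₗ f, e.surjective.comp hf, ⟨e'.trans (LinearEquiv.ofEq _ _ hk)⟩⟩,
      ⟨LinearEquiv.refl _ _⟩⟩
  | succ j ih =>
    rintro X X' X'' ⟨Z, hZ, h⟩ h2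
    exact ⟨Z, hZ, ih _ _ _ h h2⟩

lemma syz_of_fin {R : Type} [Ring R] {a : ℕ} (X X' : ModuleCat.{0} R) (f : (Fin a → R) →ₗ[R] X)
    (hf : Function.Surjective f) (e : X' ≃ₗ[R] LinearMap.ker f) : IsSyzygyOf R X' X := by
  let E := Finsupp.linearEquivFunOnFinite R R (Fin a)
  have hk : (LinearMap.ker f).comap E.toLinearMap = LinearMap.ker (f ∘ₗ E.toLinearMap) := by
    ext x
    simp
  exact ⟨Fin a, f ∘ₗ E.toLinearMap, hf.comp E.surjective,
    ⟨e.trans ((LinearEquiv.ofSubmodule' E (LinearMap.ker f)).symm.trans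
      (LinearEquiv.ofEq _ _ hk))⟩⟩

variable (a : ℕ → ℕ) (A : ∀ n, Matrix (Fin (a n)) (Fin (a (n+1))) S)

lemma syz_range (X : ModuleCat.{0} (Localization.AtPrime p))
    (f : (Fin (a 0) → Localization.AtPrime p) →ₗ[Localization.AtPrime p] X)
    (hf : Function.Surjective f) (h0 : LinearMap.range (locMat p (A 0)) = LinearMap.ker f)
    (hs : ∀ n, LinearMap.range (locMat p (A (n+1))) = LinearMap.ker (locMat p (A n))) (n : ℕ) :
    IsSyzygyIter (Localization.AtPrime p) (n+1)
      (ModuleCat.of _ (LinearMap.range (locMat p (A n)))) X := by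
  induction n with
  | zero =>
    refine syz_append 0 X X _ ⟨LinearEquiv.refl _ _⟩ (syz_of_fin _ _ f hf (LinearEquiv.ofEq _ _ h0))
  | succ n ih =>
    refine syz_append (n+1) X _ _ ih (syz_of_fin _ _ (locMat p (A n)).rangeRestrict
      (LinearMap.surjective_rangeRestrict _) (LinearEquiv.ofEq _ _ ?_))
    rw [hs, LinearMap.ker_rangeRestrict]

/-- The localization map on finite free modules. -/
def locPi (b : ℕ) : (Fin b → S) →ₗ[S] (Fin b → Localization.AtPrime p) :=
  LinearMap.pi (fun i => Algebra.linearMap S (Localization.AtPrime p) ∘ₗ LinearMap.proj i)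

instance (b : ℕ) : IsLocalizedModule p.primeCompl (locPi p b) :=
  IsLocalizedModule.pi p.primeCompl (fun _ : Fin b => Algebra.linearMap S (Localization.AtPrime p))

lemma locPi_apply (b : ℕ) (x : Fin b → S) (i : Fin b) :
    locPi p b x i = algebraMap S (Localization.AtPrime p) (x i) := rfl

lemma locMat_locPi {c b : ℕ} (B : Matrix (Fin c) (Fin b) S) (x : Fin b → S) :
    locMat p B (locPi p b x) = locPi p c (B.mulVec x) := by
  ext i
  simp [locMat_apply, locPi_apply, Matrix.mulVec, dotProduct]

lemma locPi_inj [IsDomain S] (b : ℕ) : Function.Injective (locPi p b) := by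
  intro x y h
  ext i
  have := congrFun h i
  exact IsLocalization.injective (Localization.AtPrime p) p.primeCompl_le_nonZeroDivisors this

lemma mat_comp [IsDomain S]
    (hs : ∀ n, LinearMap.range (locMat p (A (n+1))) = LinearMap.ker (locMat p (A n))) (n : ℕ) :
    A n * A (n+1) = 0 := by
  have : ∀ x : Fin (a (n+2)) → S, (A n).mulVec ((A (n+1)).mulVec x) = 0 := by
    intro x
    apply locPi_inj p
    rw [← locMat_locPi, ← locMat_locPi, map_zero]
    have : locMat p (A (n+1)) (locPi p _ x) ∈ LinearMap.ker (locMat p (A n)) := by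
      rw [← hs]; exact ⟨_, rfl⟩
    exact this
  apply Matrix.toLin'.injective
  ext1 j
  ext1
  ext i
  have := congrFun (this (Pi.single j 1)) i
  simpa [Matrix.toLin'_apply] using this

variable {M : Type} [AddCommGroup M] [Module S M] [Module.Finite S M]

lemma exists_factor [IsDomain S] [IsNoetherianRing S]
    (hs : ∀ n, LinearMap.range (locMat p (A (n+1))) = LinearMap.ker (locMat p (A n))) (n : ℕ)
    (hH : StHomTrivial (Localization.AtPrime p) (LocalizedModule p.primeCompl M)
      (LinearMap.range (locMat p (A (n+1)))))
    (u : M →ₗ[S] (Fin (a (n+1)) → S)) (hu : ∀ m, (A n).mulVec (u m) = 0) :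
    ∃ s, s ∉ p ∧ ∃ g : M →ₗ[S] (Fin (a (n+2)) → S), ∀ m, s • u m = (A (n+1)).mulVec (g m) := by
  let R := Localization.AtPrime p
  let mk := LocalizedModule.mkLinearMap p.primeCompl M
  let uR := IsLocalizedModule.mapExtendScalars p.primeCompl mk (locPi p (a (n+1))) R u
  have huR : ∀ m, uR (mk m) = locPi p _ (u m) := fun m => by
    simp only [uR, IsLocalizedModule.mapExtendScalars_apply_apply]
    exact IsLocalizedModule.map_apply _ _ _ _ _
  have hmem : ∀ x, uR x ∈ LinearMap.range (locMat p (A (n+1))) := by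
    intro x
    obtain ⟨⟨m, s⟩, hx⟩ := IsLocalizedModule.surj p.primeCompl mk x
    have h1 : locMat p (A n) (uR (mk m)) = 0 := by
      rw [huR, locMat_locPi, hu, map_zero]
    have hx' : algebraMap S R s • x = mk m := by
      rw [algebraMap_smul]; exact hx
    rw [← hx', map_smul, map_smul] at h1
    rw [hs]
    exact (IsUnit.smul_eq_zero (IsLocalization.map_units R s)).1 h1
  obtain ⟨P, α, β, hPf, hPp, hαβ⟩ := hH (uR.codRestrict _ hmem)
  obtain ⟨γ, hγ⟩ := Module.projective_lifting_property (locMat p (A (n+1))).rangeRestrict β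
    (LinearMap.surjective_rangeRestrict _)
  have hg : ∀ x, locMat p (A (n+1)) (γ (α x)) = uR x := by
    intro x
    have h1 := congrArg Subtype.val (LinearMap.congr_fun hγ (α x))
    have h2 := congrArg Subtype.val (LinearMap.congr_fun hαβ x)
    simp only [LinearMap.comp_apply, LinearMap.codRestrict_apply] at h1 h2
    rw [← h2, ← h1]
    try rfl
  have : Module.FinitePresentation S M := Module.finitePresentation_of_finite S M
  obtain ⟨g, s, hgs⟩ := Module.FinitePresentation.exists_lift_of_isLocalizedModule p.primeCompl
    (locPi p (a (n+2))) ((γ ∘ₗ α).restrictScalars S ∘ₗ mk)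
  refine ⟨s, s.2, g, fun m => ?_⟩
  apply locPi_inj p
  rw [← locMat_locPi]
  have h3 : locPi p _ (g m) = algebraMap S R s • γ (α (mk m)) := by
    have := LinearMap.congr_fun hgs m
    rw [algebraMap_smul]
    exact this
  rw [h3, LinearMap.map_smul (locMat p (A (n+1))), hg, huR, map_smul, algebraMap_smul]

lemma vProp_End [IsDomain S] [IsNoetherianRing S]
    (hs : ∀ n, LinearMap.range (locMat p (A (n+1))) = LinearMap.ker (locMat p (A n))) (n : ℕ)
    (hH : StHomTrivial (Localization.AtPrime p) (LocalizedModule p.primeCompl M)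
      (LinearMap.range (locMat p (A (n+1)))))
    (ι : S →ₗ[S] M) (π : M →ₗ[S] S) :
    VProp (Λ := Module.End S M) p (ι ∘ₗ π) a A n (Module.End S M) := by
  intro w he hA
  have hw : ∀ j m, w j m = ι (π (w j m)) := fun j m => (LinearMap.congr_fun (he j) m).symm
  obtain ⟨s, hsp, g, hg⟩ := exists_factor p a A hs n hH (LinearMap.pi fun j => π ∘ₗ w j)
    (fun m => by
      ext i
      have := congrArg π (LinearMap.congr_fun (hA i) m)
      simpa [Matrix.mulVec, dotProduct, LinearMap.sum_apply] using this)
  refine ⟨s, hsp, fun l => ι ∘ₗ LinearMap.proj l ∘ₗ g, fun j => ?_⟩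
  ext m
  have := congrArg ι (congrFun (hg m) j)
  simp only [Matrix.mulVec, dotProduct, map_sum, Pi.smul_apply, LinearMap.pi_apply,
    LinearMap.comp_apply, map_smul, ← hw, ← smul_eq_mul] at this
  simpa [LinearMap.sum_apply] using this

/-- The `End M`-submodule of elements all of whose functionals lie in `p`. -/
def dSub (p : Ideal S) (M : Type) [AddCommGroup M] [Module S M] :
    Submodule (Module.End S M) M where
  carrier := {m | ∀ φ : M →ₗ[S] S, φ m ∈ p}
  add_mem' := fun {x y} hx hy φ => by rw [map_add]; exact p.add_mem (hx φ) (hy φ)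
  zero_mem' := fun φ => by rw [map_zero]; exact p.zero_mem
  smul_mem' := fun f x hx φ => hx (φ ∘ₗ f)

lemma dim_zero (ι : S →ₗ[S] M) (π : M →ₗ[S] S) (hsummand : π.comp ι = LinearMap.id)
    (hAp : ∀ n i j, A n i j ∈ p) (n : ℕ)
    (hV : VProp (Λ := Module.End S M) p (ι ∘ₗ π) a A n (M ⧸ dSub p M)) : a (n+1) = 0 := by
  have hπι : ∀ x, π (ι x) = x := fun x => LinearMap.congr_fun hsummand x
  by_contra hne
  let z : M ⧸ dSub p M := Submodule.Quotient.mk (ι 1)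
  have hkill : ∀ (s : S), s ∈ p → ∀ y : M ⧸ dSub p M, s • y = 0 := by
    intro s hsp y
    obtain ⟨m, rfl⟩ := Submodule.Quotient.mk_surjective _ y
    rw [← Submodule.Quotient.mk_smul, Submodule.Quotient.mk_eq_zero]
    intro φ
    rw [map_smul, smul_eq_mul]
    exact p.mul_mem_right _ hsp
  obtain ⟨s, hsp, w', hw'⟩ := hV (fun _ => z) (fun j => by
      simp only [z]
      rw [← Submodule.Quotient.mk_smul]
      congr 1
      change ι (π (ι 1)) = ι 1
      rw [hπι]) (fun i => Finset.sum_eq_zero fun j _ => hkill _ (hAp _ _ _) _)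
  have h1 := hw' ⟨0, Nat.pos_of_ne_zero hne⟩
  rw [Finset.sum_eq_zero fun j _ => hkill _ (hAp _ _ _) _] at h1
  simp only [z] at h1
  rw [← Submodule.Quotient.mk_smul, Submodule.Quotient.mk_eq_zero] at h1
  have h2 := h1 π
  rw [map_smul, hπι, smul_eq_mul, mul_one] at h2
  exact hsp h2

end PartE

lemma extVan_congr {R : Type} [CommRing R] [IsLocalRing R] {V W : Type} [AddCommGroup V]
    [Module R V] [AddCommGroup W] [Module R W] (e : V ≃ₗ[R] W) (t : ℕ) (h : ExtVan R t V) :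
    ExtVan R t W := by
  intro i hi
  have := h i hi
  refine subsingleton_of_forall_eq 0 fun x => ?_
  have hid : 𝟙 (ModuleCat.of R W) = ModuleCat.ofHom e.symm.toLinearMap ≫
      ModuleCat.ofHom e.toLinearMap := by
    ext v
    simp
  have h1 : x = x.comp (Abelian.Ext.mk₀ (𝟙 (ModuleCat.of R W))) (add_zero _) := by simp
  rw [h1, hid]
  rw [← Abelian.Ext.mk₀_comp_mk₀, ← Abelian.Ext.comp_assoc_of_third_deg_zero]
  rw [Subsingleton.elim (x.comp _ _) 0, Abelian.Ext.zero_comp]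

lemma final_step {S : Type} [CommRing S] [IsNoetherianRing S] (p : Ideal S) [p.IsPrime]
    (a : ℕ → ℕ) (A : ∀ n, Matrix (Fin (a n)) (Fin (a (n+1))) S)
    (X : Type) [AddCommGroup X] [Module (Localization.AtPrime p) X]
    [Module.Finite (Localization.AtPrime p) X] (hX : IsMCM (Localization.AtPrime p) X)
    (f : (Fin (a 0) → Localization.AtPrime p) →ₗ[Localization.AtPrime p] X)
    (hAp : ∀ n i j, A n i j ∈ p)
    (hf : Function.Surjective f) (h0 : LinearMap.range (locMat p (A 0)) = LinearMap.ker f)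
    (hs : ∀ n, LinearMap.range (locMat p (A (n+1))) = LinearMap.ker (locMat p (A n)))
    (d : ℕ) (hd : ∀ n, d ≤ n → a (n+1) = 0) :
    Module.Projective (Localization.AtPrime p) X := by
  rcases subsingleton_or_nontrivial X with hsub | hnt
  · infer_instance
  have : IsNoetherianRing (Localization.AtPrime p) :=
    IsLocalization.isNoetherianRing p.primeCompl _ inferInstance
  obtain ⟨t, ht1, ht2, ht3⟩ := exists_depth (Localization.AtPrime p)
  have hXt := mcm_regular X hX t ht3
  have hr0 : ExtVan (Localization.AtPrime p) t (LinearMap.range f) :=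
    extVan_congr (LinearEquiv.ofTop _ (LinearMap.range_eq_top.2 hf)).symm t hXt
  have hr : ∀ n, ExtVan (Localization.AtPrime p) t (LinearMap.range (locMat p (A n))) := by
    intro n
    induction n with
    | zero => rw [h0]; exact extVan_ker f t (extVan_pi t _ ht1) hr0
    | succ n ih => rw [hs]; exact extVan_ker _ t (extVan_pi t _ ht1) ih
  have hm : ∀ n x i, locMat p (A n) x i ∈ IsLocalRing.maximalIdeal (Localization.AtPrime p) := by
    intro n x i
    rw [locMat_apply]
    refine Ideal.sum_mem _ fun j _ => Ideal.mul_mem_right _ _ ?_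
    exact (IsLocalization.AtPrime.to_map_mem_maximal_iff (Localization.AtPrime p) p _).2 (hAp _ _ _)
  have hinj : ∀ n, a (n+2) = 0 → Function.Injective (locMat p (A n)) := by
    intro n hn
    rw [← LinearMap.ker_eq_bot, ← hs, LinearMap.range_eq_bot]
    have : IsEmpty (Fin (a (n+1+1))) := by rw [show a (n+1+1) = 0 from hn]; infer_instance
    exact Subsingleton.elim _ _
  have hstep : ∀ n, a (n+2) = 0 → a (n+1) = 0 := by
    intro n hn
    cases n with
    | zero => exact free_ker_zero f _ (hinj 0 hn) h0 (hm 0) t hr0 ht2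
    | succ n => exact free_ker_zero _ _ (hinj (n+1) hn) (hs n) (hm (n+1)) t (hr n) ht2
  have hall : ∀ m, a (m+1) = 0 → a 1 = 0 := by
    intro m
    induction m with
    | zero => exact id
    | succ m ih => exact fun h => ih (hstep m h)
  have h1 : a (0+1) = 0 := hall d (hd d le_rfl)
  have hker : LinearMap.ker f = ⊥ := by
    rw [← h0, LinearMap.range_eq_bot]
    have : IsEmpty (Fin (a (0+1))) := by rw [h1]; infer_instance
    exact Subsingleton.elim _ _
  exact Module.Projective.of_equiv
    (LinearEquiv.ofBijective f ⟨LinearMap.ker_eq_bot.1 hker, hf⟩)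


/-- **Statement 4.** Let `S` be a Gorenstein normal domain over `k`, and let `M` be a
Cohen-Macaulay `S`-module containing `S` as a direct summand such that `End_S(M)` is a
non-commutative resolution of `S` (`M` reflexive, `End_S(M)` of finite global dimension).
Then for every prime ideal `p` of `S` the localization `M_p` is a generator of the stable
category `CM-bar(S_p)`: every Cohen-Macaulay `S_p`-module `X` with
`Hom_{CM-bar}(M_p, X[i]) = 0` for all `i ∈ ℤ` is isomorphic to `0` in `CM-bar(S_p)`
(equivalently, projective).  Shifts are expressed through syzygies, using
`Hom(M_p, X[i]) = Hom(Ω^{-i} M_p, X)` for `i ≤ 0` and `Hom(M_p, X[i]) = Hom(M_p, Ω^i X)`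
for `i ≥ 0`, since `[-1] = Ω` on `CM-bar(S_p)`. -/
theorem statement_4 (k : Type) [Field k] [IsAlgClosed k] [CharZero k]
    (S : Type) [CommRing S] [Algebra k S] [IsNoetherianRing S]
    (hdom : IsDomain S) (hnormal : IsIntegrallyClosed S) (hGor : IsGorenstein S)
    (M : Type) [AddCommGroup M] [Module S M] [Module.Finite S M]
    (hCM : IsMCM S M) (hrefl : Module.IsReflexive S M)
    (ι : S →ₗ[S] M) (π : M →ₗ[S] S) (hsummand : π.comp ι = LinearMap.id)
    (hNCR : HasFiniteGlobalDim (Module.End S M))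
    (p : PrimeSpectrum S) :
    ∀ X : ModuleCat.{0} (Localization.AtPrime p.asIdeal),
      Module.Finite (Localization.AtPrime p.asIdeal) X →
      IsMCM (Localization.AtPrime p.asIdeal) X →
      (∀ (j : ℕ) (M' : ModuleCat.{0} (Localization.AtPrime p.asIdeal)),
          IsSyzygyIter (Localization.AtPrime p.asIdeal) j M'
            (ModuleCat.of _ (LocalizedModule p.asIdeal.primeCompl M)) →
          StHomTrivial (Localization.AtPrime p.asIdeal) M' X) →
      (∀ (j : ℕ) (X' : ModuleCat.{0} (Localization.AtPrime p.asIdeal)),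
          IsSyzygyIter (Localization.AtPrime p.asIdeal) j X' X →
          StHomTrivial (Localization.AtPrime p.asIdeal)
            (LocalizedModule p.asIdeal.primeCompl M) X') →
      Module.Projective (Localization.AtPrime p.asIdeal) X := by
  intro X hXf hX _ H2
  obtain ⟨a, A, f, hAp, hf, h0, hs⟩ := exists_resolution p.asIdeal X
  obtain ⟨d, hd⟩ := hNCR
  have hπι : ∀ x, π (ι x) = x := fun x => LinearMap.congr_fun hsummand x
  refine final_step p.asIdeal a A X hX f hAp hf h0 hs d (fun n hn => ?_)
  refine dim_zero p.asIdeal a A ι π hsummand hAp n ?_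
  refine vProp_of_syz p.asIdeal _ a A ?_ (mat_comp p.asIdeal a A hs)
    (fun n => vProp_End p.asIdeal a A hs n
      (H2 (n+1+1) _ (syz_range p.asIdeal a A X f hf h0 hs (n+1))) ι π) d _
    (fun P hP => hd _ P hP) n hn
  ext m
  change ι (π (ι (π m))) = ι (π m)
  rw [hπι]

end
end

section
/- Let S be a Gorenstein normal domain over k and let Λ = End_S(⊕_{i=0}^m M_i) be a non-commutative resolution of S, where M_0 = S and each M_i is an indecomposable Cohen-Macaulay S-module. Let φ: S ↪ Λ be the canonical algebra injection induced by the S-module structure of ⊕_{i=0}^m M_i, and let e ∈ Λ be the idempotent corresponding to the direct summand S. Then Sing(Spec(S)) = Spec( φ(S)/(φ(S) ∩ ΛeΛ) ) as subschemes of Spec(S). -/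
noncomputable section
attribute [local instance] Classical.propDecidable

open MvPolynomial CategoryTheory

/-- The canonical map `S → End_S(N)`, sending `s` to scalar multiplication by `s`. -/
def scalarEnd (S : Type) [CommRing S] (N : Type) [AddCommGroup N] [Module S N] :
    S →+* Module.End S N where
  toFun s :=
    { toFun := fun x => s • x
      map_add' := fun x y => smul_add s x y
      map_smul' := fun c x => smul_comm s c x }
  map_one' := by ext x; exact one_smul _ _
  map_mul' := by intro a b; ext x; exact mul_smul a b x
  map_zero' := by ext x; exact zero_smul _ _
  map_add' := by intro a b; ext x; exact add_smul a b x

/-- The preimage in `S` of a two-sided ideal `I ⊆ A` along a ring homomorphism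
`ψ : S → A`; when `ψ` is injective this is `ψ(S) ∩ I` viewed as an ideal of `S`. -/
def pullIdeal (S : Type) [CommRing S] (A : Type) [Ring A]
    (ψ : S →+* A) (I : TwoSidedIdeal A) : Ideal S where
  carrier := {s | ψ s ∈ I}
  add_mem' := by
    intro a b ha hb
    show ψ (a + b) ∈ I
    rw [map_add]; exact I.add_mem ha hb
  zero_mem' := by show ψ 0 ∈ I; rw [map_zero]; exact I.zero_mem
  smul_mem' := by
    intro c x hx
    show ψ (c * x) ∈ I
    rw [map_mul]; exact I.mul_mem_left _ _ hx

/-- An `S`-module is indecomposable when it is nonzero and its only idempotent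
endomorphisms are `0` and `1`. -/
def IndecomposableMod (S : Type) [CommRing S] (N : Type) [AddCommGroup N] [Module S N] :
    Prop :=
  Nontrivial N ∧ ∀ f : Module.End S N, f * f = f → f = 0 ∨ f = 1


section NCRSetup

variable (S : Type) [CommRing S] (m : ℕ) (M : Fin (m + 1) → ModuleCat.{0} S)

/-- The module `M̄ = ⊕_{i=0}^{m} M_i`. -/
abbrev DirSum : Type := (i : Fin (m + 1)) → ↥(M i)

/-- The idempotent `e ∈ Λ = End_S(⊕ M_i)` corresponding to the direct summand `M 0 = S`. -/
def idemZero : Module.End S (DirSum S m M) :=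
  (LinearMap.single S (fun i => ↥(M i)) 0).comp (LinearMap.proj 0)

/-- The ideal `φ(S) ∩ ΛeΛ` of `S ≅ φ(S)`, where `φ : S → Λ` is the canonical injection
and `ΛeΛ` is the two-sided ideal of `Λ` generated by `e`. -/
def idealJ : Ideal S :=
  pullIdeal S (Module.End S (DirSum S m M)) (scalarEnd S (DirSum S m M))
    (TwoSidedIdeal.span {idemZero S m M})

end NCRSetup

/-- projective dimension at most `n`, unbundled -/
def PDim (R : Type) [Ring R] (M : Type) [AddCommGroup M] [Module R M] (n : ℕ) : Prop :=
  HasProjectiveDimensionLE (ModuleCat.of R M) n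

lemma PDim.zero_iff {R : Type} [Ring R] {M : Type} [AddCommGroup M] [Module R M] :
    PDim R M 0 ↔ Module.Projective R M := by
  unfold PDim
  rw [← projective_iff_hasProjectiveDimensionLE_zero, ← IsProjective.iff_projective]

lemma PDim.succ_iff {R : Type} [Ring R] {K P M : Type} [AddCommGroup M] [Module R M]
    [AddCommGroup K] [Module R K] [AddCommGroup P] [Module R P] (i : K →ₗ[R] P) (f : P →ₗ[R] M)
    (hi : Function.Injective i) (hf : Function.Surjective f) (hex : Function.Exact i f)
    [Module.Projective R P] (n : ℕ) : PDim R M (n + 1) ↔ PDim R K n := by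
  let T : ShortComplex (ModuleCat.{0} R) := ModuleCat.shortComplexOfCompEqZero i f
    hex.linearMap_comp_eq_zero
  have hT : T.ShortExact :=
    { exact := ModuleCat.shortComplex_exact _ hex
      mono_f := (ModuleCat.mono_iff_injective _).mpr hi
      epi_g := (ModuleCat.epi_iff_surjective _).mpr hf }
  have hP : Projective T.X₂ := (IsProjective.iff_projective (R := R) (P := P)).mp inferInstance
  exact hT.hasProjectiveDimensionLT_X₃_iff n hP

lemma PDim.retract {R : Type} [Ring R] {M N : Type} [AddCommGroup M] [Module R M]
    [AddCommGroup N] [Module R N] (i : M →ₗ[R] N) (r : N →ₗ[R] M) (h : r ∘ₗ i = LinearMap.id)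
    {n : ℕ} (hN : PDim R N n) : PDim R M n := by
  have : HasProjectiveDimensionLT (ModuleCat.of R N) (n+1) := hN
  exact Retract.hasProjectiveDimensionLT (Y := ModuleCat.of R N)
    ⟨ModuleCat.ofHom i, ModuleCat.ofHom r, by rw [← ModuleCat.ofHom_comp, h]; rfl⟩ (n+1)

lemma PDim.of_equiv {R : Type} [Ring R] {M N : Type} [AddCommGroup M] [Module R M]
    [AddCommGroup N] [Module R N] (e : M ≃ₗ[R] N)
    {n : ℕ} (hN : PDim R N n) : PDim R M n :=
  hN.retract e.toLinearMap e.symm.toLinearMap (by ext; simp)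

lemma PDim.mono {R : Type} [Ring R] {M : Type} [AddCommGroup M] [Module R M] {n k : ℕ}
    (h : PDim R M n) (hk : n ≤ k) : PDim R M k := by
  have : HasProjectiveDimensionLT (ModuleCat.of R M) (n+1) := h
  exact hasProjectiveDimensionLT_of_ge _ (n+1) (k+1) (by omega)

/-- L1 -/
lemma PDim.quot_iff {R : Type} [CommRing R] [IsNoetherianRing R] [IsLocalRing R] {x : R}
    (hx : x ∈ IsLocalRing.maximalIdeal R) (hxR : IsSMulRegular R x) (n : ℕ) :
    ∀ (K : Type) [AddCommGroup K] [Module R K] [Module.Finite R K] (_ : IsSMulRegular K x),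
    PDim (R ⧸ Ideal.span {x}) (QuotSMulTop x K) n ↔ PDim R K n := by
  have hloc : IsLocalRing (R ⧸ Ideal.span {x}) :=
    have : Nontrivial (R ⧸ Ideal.span {x}) := Ideal.Quotient.nontrivial_iff.mpr (by
      rw [Ne, Ideal.span_singleton_eq_top]; exact hx)
    IsLocalRing.of_surjective' (Ideal.Quotient.mk _) Ideal.Quotient.mk_surjective
  have hj : x ∈ (⊥ : Ideal R).jacobson := by
    rw [IsLocalRing.jacobson_eq_maximalIdeal ⊥ bot_ne_top]; exact hx
  induction n with
  | zero =>
    intro K _ _ _ hK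
    have : Module.FinitePresentation R K := Module.finitePresentation_of_finite R K
    have h1 := Module.free_quotSMulTop_iff_free R K hj hK
    rw [PDim.zero_iff, PDim.zero_iff]
    constructor
    · intro h
      have : Module.Finite (R ⧸ Ideal.span {x}) (QuotSMulTop x K) :=
        Module.Finite.of_restrictScalars_finite R _ _
      have : Module.Free (R ⧸ Ideal.span {x}) (QuotSMulTop x K) :=
        Module.free_of_flat_of_isLocalRing
      have := h1.mp this
      infer_instance
    · intro h
      have : Module.Free R K := Module.free_of_flat_of_isLocalRing
      have := h1.mpr this
      infer_instance
  | succ n ih =>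
    intro K _ _ _ hK
    obtain ⟨k, f, hf⟩ := Module.Finite.exists_fin' R K
    have hF : IsSMulRegular (Fin k → R) x := by
      intro a b hab
      ext i
      exact hxR (congrFun hab i)
    have hL : IsSMulRegular (LinearMap.ker f) x := by
      intro a b hab
      apply Subtype.ext
      exact hF (congrArg Subtype.val hab)
    rw [PDim.succ_iff (LinearMap.ker f).subtype f (Submodule.injective_subtype _) hf
      (LinearMap.exact_subtype_ker_map f) n]
    rw [← ih (LinearMap.ker f) hL]
    let i' := QuotSMulTop.map x (LinearMap.ker f).subtype
    let f' := QuotSMulTop.map x f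
    have hex : Function.Exact i' f' := QuotSMulTop.map_exact x (LinearMap.exact_subtype_ker_map f) hf
    have hf' : Function.Surjective f' := QuotSMulTop.map_surjective x hf
    have hi' : Function.Injective i' := by
      rw [injective_iff_map_eq_zero]
      intro a ha
      obtain ⟨a, rfl⟩ := Submodule.Quotient.mk_surjective _ a
      have h2 : (Submodule.Quotient.mk (a : Fin k → R) : QuotSMulTop x (Fin k → R)) = 0 := ha
      rw [Submodule.Quotient.mk_eq_zero] at h2 ⊢
      rw [Submodule.mem_smul_pointwise_iff_exists] at h2 ⊢
      obtain ⟨b, -, hb⟩ := h2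
      have hb0 : f b = 0 := by
        apply hK
        have : f (x • b) = 0 := by rw [hb]; exact a.2
        simpa using this
      exact ⟨⟨b, hb0⟩, trivial, Subtype.ext hb⟩
    have hs : Function.Surjective (algebraMap R (R ⧸ Ideal.span {x})) := Ideal.Quotient.mk_surjective
    exact PDim.succ_iff (i'.extendScalarsOfSurjective hs) (f'.extendScalarsOfSurjective hs)
      hi' hf' hex n


open IsLocalRing in
/-- L0 -/
lemma spanFinrank_quot {R : Type} [CommRing R] [IsNoetherianRing R] [IsLocalRing R] {x : R}
    (hx : x ∈ maximalIdeal R) (hx2 : x ∉ maximalIdeal R ^ 2)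
    [IsLocalRing (R ⧸ Ideal.span {x})] :
    (maximalIdeal (R ⧸ Ideal.span {x})).spanFinrank + 1 ≤ (maximalIdeal R).spanFinrank := by
  rw [spanFinrank_maximalIdeal_eq_finrank_cotangentSpace R]
  let V := CotangentSpace R
  let v : V := (maximalIdeal R).toCotangent ⟨x, hx⟩
  have hv : v ≠ 0 := by
    intro h
    exact hx2 (((maximalIdeal R).toCotangent_eq_zero ⟨x, hx⟩).mp h)
  have hs : LinearIndepOn (ResidueField R) id ({v} : Set V) := by
    rw [linearIndepOn_singleton_iff]; exact hv
  let b := hs.extend (Set.subset_univ _)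
  let B := Module.Basis.extend hs
  have hvb : v ∈ b := hs.subset_extend _ rfl
  have hbfin : b.Finite := Module.Finite.finite_basis B
  have hcard : Module.finrank (ResidueField R) V = b.ncard := by
    rw [Module.finrank_eq_nat_card_basis B]; rfl
  obtain ⟨g, hg⟩ := ((maximalIdeal R).toCotangent_surjective).hasRightInverse
  let Y : Set (maximalIdeal R) := g '' (b \ {v})
  let x' : maximalIdeal R := ⟨x, hx⟩
  have hspan : Submodule.span R (insert x' Y) = ⊤ := by
    rw [← CotangentSpace.span_image_eq_top_iff]
    have : (maximalIdeal R).toCotangent '' (insert x' Y) = b := by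
      rw [Set.image_insert_eq, ← Set.image_comp]
      have : (b \ {v}).image ((maximalIdeal R).toCotangent ∘ g) = b \ {v} := by
        ext z
        constructor
        · rintro ⟨y, hy, rfl⟩
          rw [Function.comp_apply, hg y]; exact hy
        · intro hz
          exact ⟨z, hz, hg z⟩
      rw [this]
      exact Set.insert_sdiff_self_of_mem hvb
    rw [this]
    have := B.span_eq
    rwa [Module.Basis.range_extend] at this
  have hspan2 : Ideal.span (insert x (Subtype.val '' Y)) = maximalIdeal R := by
    have h3 := congrArg (Submodule.map (maximalIdeal R).subtype) hspan
    rw [Submodule.map_span, Submodule.map_top, Submodule.range_subtype, Set.image_insert_eq] at h3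
    exact h3
  let q := Ideal.Quotient.mk (Ideal.span {x})
  have hm' : maximalIdeal (R ⧸ Ideal.span {x}) = Ideal.span (q '' (Subtype.val '' Y)) := by
    have h1 : (maximalIdeal R).map q = maximalIdeal (R ⧸ Ideal.span {x}) := by
      have hq : Function.Surjective q := Ideal.Quotient.mk_surjective
      have hl := IsLocalRing.map_maximalIdeal_of_surjective q hq
      exact hl
    have : q x = 0 := Ideal.Quotient.eq_zero_iff_mem.mpr (Ideal.mem_span_singleton_self x)
    have h2 := congrArg (Ideal.map q) hspan2
    rw [Ideal.map_span, Set.image_insert_eq, this, Ideal.span_insert_zero] at h2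
    exact h1.symm.trans h2.symm
  have hfinY : (q '' (Subtype.val '' Y)).Finite :=
    (((hbfin.subset Set.sdiff_subset).image g).image _).image _
  have h1 : (maximalIdeal (R ⧸ Ideal.span {x})).spanFinrank ≤ (b \ {v}).ncard := by
    rw [hm']
    refine (Submodule.spanFinrank_span_le_ncard_of_finite hfinY).trans ?_
    refine (Set.ncard_image_le (((hbfin.subset Set.sdiff_subset).image g).image _)).trans ?_
    refine (Set.ncard_image_le ((hbfin.subset Set.sdiff_subset).image g)).trans ?_
    exact Set.ncard_image_le (hbfin.subset Set.sdiff_subset)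
  have h2 := Set.ncard_sdiff_singleton_add_one hvb hbfin
  change _ ≤ Module.finrank (ResidueField R) V
  omega

open IsLocalRing in
lemma spanFinrank_le_quot {R : Type} [CommRing R] [IsNoetherianRing R] [IsLocalRing R] {x : R}
    (hx : x ∈ maximalIdeal R) [IsLocalRing (R ⧸ Ideal.span {x})] :
    (maximalIdeal R).spanFinrank ≤ (maximalIdeal (R ⧸ Ideal.span {x})).spanFinrank + 1 := by
  let q := Ideal.Quotient.mk (Ideal.span {x})
  obtain ⟨g, hg⟩ := (Ideal.Quotient.mk_surjective (I := Ideal.span {x})).hasRightInverse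
  have hfg : (maximalIdeal (R ⧸ Ideal.span {x})).FG := Ideal.fg_of_isNoetherianRing _
  let G := (maximalIdeal (R ⧸ Ideal.span {x})).generators
  have hGfin : G.Finite := Submodule.FG.finite_generators hfg
  have hG : Ideal.span G = maximalIdeal (R ⧸ Ideal.span {x}) := Submodule.span_generators _
  have hGc : G.ncard = (maximalIdeal (R ⧸ Ideal.span {x})).spanFinrank :=
    Submodule.FG.generators_ncard hfg
  have hs : maximalIdeal R = Ideal.span (insert x (g '' G)) := by
    have h1 : (maximalIdeal (R ⧸ Ideal.span {x})).comap q = maximalIdeal R := by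
      have : ((maximalIdeal (R ⧸ Ideal.span {x})).comap q).IsMaximal :=
        Ideal.comap_isMaximal_of_surjective q Ideal.Quotient.mk_surjective
      exact IsLocalRing.eq_maximalIdeal this
    have h2 : (Ideal.span (g '' G)).map q = Ideal.span G := by
      rw [Ideal.map_span, ← Set.image_comp]
      congr 1
      ext z
      constructor
      · rintro ⟨y, hy, rfl⟩
        rw [Function.comp_apply, hg y]; exact hy
      · intro hz
        exact ⟨z, hz, hg z⟩
    rw [← h1, ← hG, ← h2, Ideal.comap_map_of_surjective q Ideal.Quotient.mk_surjective,
      ← RingHom.ker_eq_comap_bot, Ideal.mk_ker, Ideal.span_insert, sup_comm]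
  calc _ = (Ideal.span (insert x (g '' G))).spanFinrank := by rw [← hs]
    _ ≤ (insert x (g '' G)).ncard :=
      Submodule.spanFinrank_span_le_ncard_of_finite ((hGfin.image g).insert x)
    _ ≤ (g '' G).ncard + 1 := Set.ncard_insert_le _ _
    _ ≤ G.ncard + 1 := by gcongr; exact Set.ncard_image_le hGfin
    _ = _ := by rw [hGc]

lemma isLocalRing_quot {R : Type} [CommRing R] [IsLocalRing R] {x : R}
    (hx : x ∈ IsLocalRing.maximalIdeal R) : IsLocalRing (R ⧸ Ideal.span {x}) :=
    have : Nontrivial (R ⧸ Ideal.span {x}) := Ideal.Quotient.nontrivial_iff.mpr (by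
      rw [Ne, Ideal.span_singleton_eq_top]; exact hx)
    IsLocalRing.of_surjective' (Ideal.Quotient.mk _) Ideal.Quotient.mk_surjective

open IsLocalRing in
lemma exists_avoid {R : Type} [CommRing R] [IsNoetherianRing R] [IsLocalRing R]
    (hm : maximalIdeal R ≠ ⊥) (s : Set (Ideal R)) (hs : s.Finite) (hp : ∀ q ∈ s, q.IsPrime)
    (hms : maximalIdeal R ∉ s) :
    ∃ x ∈ maximalIdeal R, x ∉ maximalIdeal R ^ 2 ∧ ∀ q ∈ s, x ∉ q := by
  by_contra! hcon
  have h := (Ideal.subset_iUnion_iff_mem_of_isMaximal_of_finite (M := maximalIdeal R)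
    (S := insert (maximalIdeal R ^ 2) s) (hs.insert _) (maximalIdeal R ^ 2) (maximalIdeal R ^ 2)
    (by
      intro I hI h1 _
      rcases hI with rfl | hI
      · exact absurd rfl h1
      · exact hp I hI)
    (by
      intro h
      have := Ideal.pow_le_self (I := maximalIdeal R) (n := 2) (by norm_num)
      rw [h] at this
      exact (maximalIdeal.isMaximal R).ne_top (top_le_iff.mp this))
    (by
      intro h
      have := Ideal.pow_le_self (I := maximalIdeal R) (n := 2) (by norm_num)
      rw [h] at this
      exact (maximalIdeal.isMaximal R).ne_top (top_le_iff.mp this))).mp (by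
      intro x hx
      by_cases h2 : x ∈ maximalIdeal R ^ 2
      · exact Set.mem_biUnion (Set.mem_insert _ _) h2
      · obtain ⟨q, hq, hxq⟩ := hcon x hx h2
        exact Set.mem_biUnion (Set.mem_insert_of_mem _ hq) hxq)
  rcases h with h | h
  · apply hm
    have h3 : maximalIdeal R ≤ maximalIdeal R • maximalIdeal R := by
      rw [smul_eq_mul, ← pow_two, ← h]
    exact Submodule.eq_bot_of_le_smul_of_le_jacobson_bot _ _ (Ideal.fg_of_isNoetherianRing _) h3
      (maximalIdeal_le_jacobson _)
  · exact hms h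


lemma exists_nat_dim (R : Type) [CommRing R] [IsLocalRing R] [IsNoetherianRing R] :
    ∃ n : ℕ, ringKrullDim R = n := by
  rw [← IsLocalRing.maximalIdeal_height_eq_ringKrullDim (R := R)]
  obtain ⟨n, hn⟩ := ENat.ne_top_iff_exists.mp (Ideal.height_ne_top
    (I := IsLocalRing.maximalIdeal R) (Ideal.IsPrime.ne_top inferInstance))
  exact ⟨n, by rw [← hn]; rfl⟩

open IsLocalRing in
lemma reg_quot {R : Type} [CommRing R] [IsRegularLocalRing R] (hne : maximalIdeal R ≠ ⊥) :
    ∃ x ∈ maximalIdeal R, (∀ q ∈ minimalPrimes R, x ∉ q) ∧ IsRegularLocalRing (R ⧸ Ideal.span {x}) ∧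
      ∀ [IsLocalRing (R ⧸ Ideal.span {x})],
        (maximalIdeal (R ⧸ Ideal.span {x})).spanFinrank < (maximalIdeal R).spanFinrank := by
  have hdim := (isRegularLocalRing_iff R).mp inferInstance
  have hm : maximalIdeal R ∉ minimalPrimes R := by
    intro h
    have h0 : (maximalIdeal R).height = 0 := by
      exact Ideal.height_eq_zero_iff.mpr h
    have := maximalIdeal_height_eq_ringKrullDim (R := R)
    rw [h0] at this
    rw [← this] at hdim
    have h1 : (maximalIdeal R).spanFinrank = 0 := by exact_mod_cast hdim
    exact hne ((Submodule.spanFinrank_eq_zero_iff_eq_bot (Ideal.fg_of_isNoetherianRing _)).mp h1)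
  obtain ⟨x, hx, hx2, hxq⟩ := exists_avoid hne (minimalPrimes R)
    (minimalPrimes.finite_of_isNoetherianRing R) (fun q hq => hq.1.1) hm
  have hl := isLocalRing_quot hx
  have h1 := spanFinrank_quot hx hx2
  have h2 := ringKrullDim_le_ringKrullDim_quotient_add_card (R := R) {x} (by
    rw [IsLocalRing.ringJacobson_eq_maximalIdeal]; simpa using hx)
  rw [Finset.coe_singleton, ← hdim, Finset.card_singleton] at h2
  refine ⟨x, hx, hxq, ?_, ?_⟩
  · apply IsRegularLocalRing.of_spanFinrank_maximalIdeal_le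
    have h3 : (((maximalIdeal (R ⧸ Ideal.span {x})).spanFinrank + 1 : ℕ) : WithBot ℕ∞)
      ≤ ringKrullDim (R ⧸ Ideal.span {x}) + (1 : ℕ) := le_trans (by exact_mod_cast h1) h2
    obtain ⟨d, hd⟩ := exists_nat_dim (R ⧸ Ideal.span {x})
    rw [hd] at h3 ⊢
    have h4 : (maximalIdeal (R ⧸ Ideal.span {x})).spanFinrank + 1 ≤ d + 1 := by exact_mod_cast h3
    exact_mod_cast Nat.le_of_succ_le_succ h4
  · intro _; exact Nat.lt_of_succ_le h1

open IsLocalRing in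
lemma reg_domain_aux (n : ℕ) : ∀ (R : Type) [CommRing R] [IsRegularLocalRing R],
    (maximalIdeal R).spanFinrank ≤ n → IsDomain R := by
  induction n with
  | zero =>
    intro R _ _ h
    have : maximalIdeal R = ⊥ := (Submodule.spanFinrank_eq_zero_iff_eq_bot
      (Ideal.fg_of_isNoetherianRing _)).mp (Nat.le_zero.mp h)
    exact ((isField_iff_maximalIdeal_eq (R := R)).mpr this).isDomain
  | succ n ih =>
    intro R _ _ h
    by_cases hne : maximalIdeal R = ⊥
    · exact ((isField_iff_maximalIdeal_eq (R := R)).mpr hne).isDomain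
    obtain ⟨x, hx, hxq, hreg, hlt⟩ := reg_quot hne
    have hD := ih (R ⧸ Ideal.span {x}) (by have := @hlt _; omega)
    have hP : (Ideal.span {x}).IsPrime := (Ideal.Quotient.isDomain_iff_prime _).mp hD
    obtain ⟨q, hq, hqx⟩ := Ideal.exists_minimalPrimes_le (I := ⊥) (J := Ideal.span {x}) bot_le
    have hqp : q.IsPrime := hq.1.1
    have : q ≤ maximalIdeal R • q := by
      intro y hy
      obtain ⟨z, rfl⟩ := Ideal.mem_span_singleton.mp (hqx hy)
      exact Submodule.smul_mem_smul hx ((hqp.mem_or_mem hy).resolve_left (hxq q hq))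
    have hq0 : q = ⊥ := Submodule.eq_bot_of_le_smul_of_le_jacobson_bot _ _
      (Ideal.fg_of_isNoetherianRing _) this (maximalIdeal_le_jacobson _)
    rw [hq0] at hqp
    exact IsDomain.of_bot_isPrime R

lemma reg_domain (R : Type) [CommRing R] [IsRegularLocalRing R] : IsDomain R :=
  reg_domain_aux _ R le_rfl

open IsLocalRing in
/-- L2 -/
lemma reg_finite_pd_aux (n : ℕ) : ∀ (R : Type) [CommRing R] [IsRegularLocalRing R],
    (maximalIdeal R).spanFinrank ≤ n → ∀ (M : Type) [AddCommGroup M] [Module R M]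
      [Module.Finite R M], ∃ k, PDim R M k := by
  have key : ∀ (R : Type) [CommRing R] [IsRegularLocalRing R], maximalIdeal R = ⊥ →
      ∀ (M : Type) [AddCommGroup M] [Module R M], ∃ k, PDim R M k := by
    intro R _ _ h M _ _
    have hF : IsField R := isField_iff_maximalIdeal_eq.mpr h
    refine ⟨0, PDim.zero_iff.mpr ?_⟩
    let F := hF.toField
    have h2 : Module.Free R M := @Module.Free.of_divisionRing R M
      (@Field.toDivisionRing R F) _ _
    infer_instance
  induction n with
  | zero =>
    intro R _ _ h M _ _ _
    exact key R ((Submodule.spanFinrank_eq_zero_iff_eq_bot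
      (Ideal.fg_of_isNoetherianRing _)).mp (Nat.le_zero.mp h)) M
  | succ n ih =>
    intro R _ _ h M _ _ _
    by_cases hne : maximalIdeal R = ⊥
    · exact key R hne M
    obtain ⟨x, hx, hxq, hreg, hlt⟩ := reg_quot hne
    have hD := reg_domain R
    have hx0 : x ≠ 0 := by
      rintro rfl
      obtain ⟨q, hq, hqx⟩ := Ideal.exists_minimalPrimes_le (I := (⊥ : Ideal R))
        (J := maximalIdeal R) bot_le
      exact hxq q hq (Ideal.zero_mem _)
    have hxR : IsSMulRegular R x := fun a b hab => mul_left_cancel₀ hx0 hab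
    obtain ⟨k, f, hf⟩ := Module.Finite.exists_fin' R M
    have hL : IsSMulRegular (LinearMap.ker f) x := by
      intro a b hab
      apply Subtype.ext
      ext i
      exact hxR (congrFun (congrArg Subtype.val hab) i)
    have : Module.Finite (R ⧸ Ideal.span {x}) (QuotSMulTop x (LinearMap.ker f)) :=
        Module.Finite.of_restrictScalars_finite R _ _
    obtain ⟨d, hd⟩ := ih (R ⧸ Ideal.span {x}) (by have := @hlt _; omega)
      (QuotSMulTop x (LinearMap.ker f))
    exact ⟨d + 1, (PDim.succ_iff (LinearMap.ker f).subtype f (Submodule.injective_subtype _) hf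
      (LinearMap.exact_subtype_ker_map f) d).mpr ((PDim.quot_iff hx hxR d _ hL).mp hd)⟩

lemma reg_finite_pd (R : Type) [CommRing R] [IsRegularLocalRing R] (M : Type) [AddCommGroup M]
    [Module R M] [Module.Finite R M] : ∃ k, PDim R M k :=
  reg_finite_pd_aux _ R le_rfl M


lemma projective_of_split {R : Type} [CommRing R] {F M : Type} [AddCommGroup M] [Module R M]
    [AddCommGroup F] [Module R F] [Module.Projective R F] (f : F →ₗ[R] M) (hf : Function.Surjective f)
    (l : F →ₗ[R] LinearMap.ker f) (hl : l ∘ₗ (LinearMap.ker f).subtype = LinearMap.id) :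
    Module.Projective R M := by
  let g : (F ⧸ LinearMap.ker f) →ₗ[R] F := (LinearMap.ker f).liftQ
    (LinearMap.id - (LinearMap.ker f).subtype ∘ₗ l) (by
      intro z hz
      have := LinearMap.congr_fun hl ⟨z, hz⟩
      have h2 : l z = ⟨z, hz⟩ := this
      simp [h2])
  let E := LinearMap.quotKerEquivOfSurjective f hf
  refine Module.Projective.of_split (g ∘ₗ E.symm.toLinearMap) f ?_
  ext y
  obtain ⟨z, rfl⟩ := hf y
  have : E.symm (f z) = Submodule.Quotient.mk z := by
    rw [LinearEquiv.symm_apply_eq]; rfl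
  simp [this, g]

open IsLocalRing in
/-- L5 -/
lemma projective_of_socle {R : Type} [CommRing R] [IsNoetherianRing R] [IsLocalRing R]
    {a : R} (ha : a ≠ 0) (ham : ∀ y ∈ maximalIdeal R, a * y = 0) (n : ℕ) :
    ∀ (M : Type) [AddCommGroup M] [Module R M] [Module.Finite R M], PDim R M n →
      Module.Projective R M := by
  induction n with
  | zero => intro M _ _ _ h; exact PDim.zero_iff.mp h
  | succ n ih =>
    intro M _ _ _ h
    obtain ⟨k, f, hf⟩ := Module.Finite.exists_fin' R M
    have hK := ih (LinearMap.ker f) ((PDim.succ_iff (LinearMap.ker f).subtype f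
      (Submodule.injective_subtype _) hf (LinearMap.exact_subtype_ker_map f) n).mp h)
    have : Module.FinitePresentation R (LinearMap.ker f) := Module.finitePresentation_of_finite R _
    have hfree : Module.Free R (LinearMap.ker f) := Module.free_of_flat_of_isLocalRing
    have hinj : Function.Injective ((LinearMap.ker f).subtype.lTensor (ResidueField R)) := by
      rw [injective_iff_map_eq_zero]
      intro t ht
      obtain ⟨z, rfl⟩ := TensorProduct.mk_surjective R (LinearMap.ker f) (ResidueField R)
        (residue_surjective) t
      rw [TensorProduct.mk_apply, LinearMap.lTensor_tmul] at ht
      have hz : a • z = 0 := by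
        apply Subtype.ext
        funext j
        change a * (z : Fin k → R) j = 0
        apply ham
        have h1 := congrArg ((TensorProduct.rid R (ResidueField R)) ∘
          ((LinearMap.proj j : (Fin k → R) →ₗ[R] R).lTensor (ResidueField R))) ht
        simp [Algebra.smul_def] at h1
        exact h1
      let b := Module.Free.chooseBasis R (LinearMap.ker f)
      have hc : ∀ j, b.repr z j ∈ maximalIdeal R := by
        intro j
        by_contra hu
        have hu' : IsUnit (b.repr z j) := by simpa using hu
        have : a * b.repr z j = 0 := by
          have := congrArg (fun w => b.repr w j) hz
          simpa using this
        exact ha (hu'.mul_left_eq_zero.mp this)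
      rw [TensorProduct.mk_apply, ← b.sum_repr z, TensorProduct.tmul_sum]
      refine Finset.sum_eq_zero fun j _ => ?_
      rw [← TensorProduct.smul_tmul]
      have : (b.repr z j) • (1 : ResidueField R) = 0 := by
        rw [Algebra.smul_def, mul_one]
        exact (residue_eq_zero_iff _).mpr (hc j)
      rw [this, TensorProduct.zero_tmul]
    obtain ⟨l, hl⟩ := (IsLocalRing.split_injective_iff_lTensor_residueField_injective _).mpr hinj
    exact projective_of_split f hf l hl

open IsLocalRing in
/-- L4 -/
lemma residue_retract {R : Type} [CommRing R] [IsNoetherianRing R] [IsLocalRing R] {x : R}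
    (hx : x ∈ maximalIdeal R) (hx2 : x ∉ maximalIdeal R ^ 2) [IsLocalRing (R ⧸ Ideal.span {x})] :
    ∃ (i : ResidueField (R ⧸ Ideal.span {x}) →ₗ[R ⧸ Ideal.span {x}]
        QuotSMulTop x (maximalIdeal R))
      (r : QuotSMulTop x (maximalIdeal R) →ₗ[R ⧸ Ideal.span {x}]
        ResidueField (R ⧸ Ideal.span {x})), r ∘ₗ i = LinearMap.id := by
  let R' := R ⧸ Ideal.span {x}
  let κ' := ResidueField R'
  let Q := QuotSMulTop x (maximalIdeal R)
  have hs : Function.Surjective (algebraMap R R') := Ideal.Quotient.mk_surjective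
  let π : R →ₗ[R] κ' := Algebra.linearMap R κ'
  have hπ : Function.Surjective π := (residue_surjective (R := R')).comp hs
  have hker : LinearMap.ker π = maximalIdeal R := by
    have h1 : RingHom.ker (algebraMap R κ') = maximalIdeal R :=
      IsLocalRing.eq_maximalIdeal (RingHom.ker_isMaximal_of_surjective _ hπ)
    exact h1
  let xb : Q := Submodule.Quotient.mk ⟨x, hx⟩
  let i0 : R →ₗ[R] Q := LinearMap.toSpanSingleton R Q xb
  have hi0 : LinearMap.ker π ≤ LinearMap.ker i0 := by
    rw [hker]
    intro y hy
    change y • xb = 0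
    change (Submodule.Quotient.mk (y • (⟨x, hx⟩ : maximalIdeal R)) : Q) = 0
    rw [Submodule.Quotient.mk_eq_zero, Submodule.mem_smul_pointwise_iff_exists]
    exact ⟨⟨y, hy⟩, trivial, Subtype.ext (mul_comm _ _)⟩
  let E := LinearMap.quotKerEquivOfSurjective π hπ
  let i : κ' →ₗ[R] Q := (LinearMap.ker π).liftQ i0 hi0 ∘ₗ E.symm.toLinearMap
  have hi : ∀ c, i (π c) = c • xb := by
    intro c
    have : E.symm (π c) = Submodule.Quotient.mk c := by
      rw [LinearEquiv.symm_apply_eq]; rfl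
    simp only [i, LinearMap.comp_apply, LinearEquiv.coe_coe, this]
    rfl
  let v : CotangentSpace R := (maximalIdeal R).toCotangent ⟨x, hx⟩
  have hv : v ≠ 0 := by
    intro h
    exact hx2 (((maximalIdeal R).toCotangent_eq_zero ⟨x, hx⟩).mp h)
  obtain ⟨g, hg⟩ := Module.Projective.exists_dual_ne_zero (ResidueField R) hv
  let g1 : CotangentSpace R →ₗ[ResidueField R] ResidueField R := (g v)⁻¹ • g
  have hg1 : g1 v = 1 := by
    simp [g1, inv_mul_cancel₀ hg]
  let r0 : maximalIdeal R →ₗ[R] ResidueField R :=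
    (g1.restrictScalars R) ∘ₗ (maximalIdeal R).toCotangent
  let φ : ResidueField R →ₗ[R] κ' := Submodule.liftQ (maximalIdeal R) π hker.ge
  let r : Q →ₗ[R] κ' := Submodule.liftQ _ (φ ∘ₗ r0) (by
    intro y hy
    rw [Submodule.mem_smul_pointwise_iff_exists] at hy
    obtain ⟨z, -, rfl⟩ := hy
    rw [LinearMap.mem_ker, map_smul]
    have : π x = 0 := by rw [← LinearMap.mem_ker, hker]; exact hx
    have h2 : (algebraMap R κ') x = 0 := this
    rw [Algebra.smul_def, h2, zero_mul])
  have hri : r ∘ₗ i = LinearMap.id := by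
    apply LinearMap.ext
    intro y
    obtain ⟨c, rfl⟩ := hπ y
    rw [LinearMap.comp_apply, hi, map_smul]
    have : r xb = π 1 := by
      change φ (g1 v) = _
      rw [hg1]; rfl
    rw [this, ← map_smul, smul_eq_mul, mul_one]; rfl
  exact ⟨i.extendScalarsOfSurjective hs, r.extendScalarsOfSurjective hs, by
    apply LinearMap.ext; intro y; exact LinearMap.congr_fun hri y⟩


lemma residue_one_ne (R : Type) [CommRing R] [IsLocalRing R] :
    (1 : IsLocalRing.ResidueField R) ≠ 0 := one_ne_zero

lemma zero_of_projective {R : Type} [CommRing R] [IsNoetherianRing R] [IsLocalRing R]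
    (K : Type) [AddCommGroup K] [Module R K] [Module.Finite R K] [Module.Projective R K] (z : K)
    (hz : z ≠ 0) (y : R) (hy : ∀ z : K, y • z = 0) : y = 0 := by
  have : Module.FinitePresentation R K := Module.finitePresentation_of_finite R _
  have hfree : Module.Free R K := Module.free_of_flat_of_isLocalRing
  have : Nontrivial K := ⟨z, 0, hz⟩
  obtain ⟨j⟩ := (Module.Free.chooseBasis R K).index_nonempty
  have h1 := congrArg (fun w => (Module.Free.chooseBasis R K).repr w j)
    (hy (Module.Free.chooseBasis R K j))
  simpa using h1

open IsLocalRing in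
lemma serre_aux (N : ℕ) : ∀ (R : Type) [CommRing R] [IsNoetherianRing R] [IsLocalRing R],
    (maximalIdeal R).spanFinrank ≤ N → ∀ n, PDim R (ResidueField R) n → IsRegularLocalRing R := by
  have key : ∀ (R : Type) [CommRing R] [IsNoetherianRing R] [IsLocalRing R],
      maximalIdeal R = ⊥ → IsRegularLocalRing R := by
    intro R _ _ _ h
    apply IsRegularLocalRing.of_spanFinrank_maximalIdeal_le
    rw [h, Submodule.spanFinrank_bot]
    exact_mod_cast ringKrullDim_nonneg_of_nontrivial
  induction N with
  | zero =>
    intro R _ _ _ h n hn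
    exact key R ((Submodule.spanFinrank_eq_zero_iff_eq_bot
      (Ideal.fg_of_isNoetherianRing _)).mp (Nat.le_zero.mp h))
  | succ N ih =>
    intro R _ _ _ h n hn
    by_cases hne : maximalIdeal R = ⊥
    · exact key R hne
    by_cases hass : maximalIdeal R ∈ associatedPrimes R R
    · exfalso
      obtain ⟨-, a, ha⟩ := isAssociatedPrime_iff.mp hass
      have ha0 : a ≠ 0 := by
        rintro rfl
        apply (maximalIdeal.isMaximal R).ne_top
        rw [ha, Ideal.eq_top_iff_one]
        simp [Submodule.mem_colon_singleton]
      have ham : ∀ y ∈ maximalIdeal R, a * y = 0 := by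
        intro y hy
        rw [ha, Submodule.mem_colon_singleton] at hy
        simpa [mul_comm] using hy
      have hproj := projective_of_socle ha0 ham n (ResidueField R) hn
      have htf : ∀ y ∈ maximalIdeal R, y = 0 := by
        intro y hy
        refine zero_of_projective (ResidueField R) 1 (residue_one_ne R) y fun z => ?_
        rw [Algebra.smul_def]
        rw [show algebraMap R (ResidueField R) y = 0 from (residue_eq_zero_iff _).mpr hy,
              zero_mul]
      exact hne (eq_bot_iff.mpr fun y hy => htf y hy)
    obtain ⟨x, hx, hx2, hxq⟩ := exists_avoid hne (associatedPrimes R R)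
      (associatedPrimes.finite R R) (fun q hq => IsAssociatedPrime.isPrime hq) hass
    have hxR : IsSMulRegular R x := by
      by_contra hcon
      have : x ∈ ⋃ p ∈ associatedPrimes R R, (p : Set R) := by
        rw [biUnion_associatedPrimes_eq_compl_regular]
        exact hcon
      simp only [Set.mem_iUnion] at this
      obtain ⟨q, hq, hxq'⟩ := this
      exact hxq q hq hxq'
    have hl := isLocalRing_quot hx
    have h1 := spanFinrank_quot hx hx2
    have hmreg : IsSMulRegular (maximalIdeal R) x := by
      intro a b hab
      exact Subtype.ext (hxR (congrArg Subtype.val hab))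
    have hpd : PDim R (maximalIdeal R) n := by
      refine (PDim.succ_iff (maximalIdeal R).subtype (Algebra.linearMap R (ResidueField R))
        (Submodule.injective_subtype _) residue_surjective ?_ n).mp (hn.mono (Nat.le_succ n))
      intro y
      change residue R y = 0 ↔ _
      rw [residue_eq_zero_iff]
      simp
    obtain ⟨i, r, hir⟩ := residue_retract hx hx2
    have hpd' := ((PDim.quot_iff hx hxR n _ hmreg).mpr hpd).retract i r hir
    have hreg := ih (R ⧸ Ideal.span {x}) (by omega) n hpd'
    have h2 := (isRegularLocalRing_iff (R ⧸ Ideal.span {x})).mp hreg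
    have h3 := spanFinrank_le_quot hx
    have h4 := ringKrullDim_quotient_succ_le_of_nonZeroDivisor (r := x) (by
      rw [mem_nonZeroDivisors_iff_right]
      intro z hz
      apply hxR
      simpa [mul_comm] using hz)
    apply IsRegularLocalRing.of_spanFinrank_maximalIdeal_le
    refine le_trans ?_ h4
    rw [← h2]
    exact_mod_cast h3

lemma serre (R : Type) [CommRing R] [IsNoetherianRing R] [IsLocalRing R] (n : ℕ)
    (h : PDim R (IsLocalRing.ResidueField R) n) : IsRegularLocalRing R :=
  serre_aux _ R le_rfl n h


lemma isRegularLocal_iff (R : Type) [CommRing R] [IsLocalRing R] :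
    IsRegularLocal R ↔ IsRegularLocalRing R := by
  constructor
  · rintro ⟨hN, s, hs, hc⟩
    apply IsRegularLocalRing.of_spanFinrank_maximalIdeal_le
    have hc' : ((s.card : ℕ) : WithBot ℕ∞) = ringKrullDim R := hc
    rw [← hs, ← hc']
    have := Submodule.spanFinrank_span_le_ncard_of_finite (R := R) (s := (s : Set R)) s.finite_toSet
    rw [Set.ncard_coe_finset] at this
    exact_mod_cast this
  · intro h
    have hfg : (IsLocalRing.maximalIdeal R).FG := Ideal.fg_of_isNoetherianRing _
    have hfin := Submodule.FG.finite_generators hfg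
    refine ⟨inferInstance, hfin.toFinset, ?_, ?_⟩
    · rw [Set.Finite.coe_toFinset]; exact Submodule.span_generators _
    · rw [← (isRegularLocalRing_iff R).mp h, ← Submodule.FG.generators_ncard hfg,
        Set.ncard_eq_toFinset_card _ hfin]
      rfl

/-- `f` factors through a finite free module. -/
def Fac {S : Type} [CommRing S] {X Y : Type} [AddCommGroup X] [Module S X] [AddCommGroup Y]
    [Module S Y] (f : X →ₗ[S] Y) : Prop :=
  ∃ (P : ModuleCat.{0} S), Module.Finite S P ∧ Module.Free S P ∧
    ∃ (a : X →ₗ[S] P) (b : P →ₗ[S] Y), b ∘ₗ a = f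

section FacL
variable {S : Type} [CommRing S] {X Y Z : Type} [AddCommGroup X] [Module S X] [AddCommGroup Y]
    [Module S Y] [AddCommGroup Z] [Module S Z]

lemma Fac.mk' {P : Type} [AddCommGroup P] [Module S P] [Module.Finite S P] [Module.Free S P]
    (a : X →ₗ[S] P) (b : P →ₗ[S] Y) : Fac (b ∘ₗ a) :=
  ⟨ModuleCat.of S P, ‹_›, ‹_›, a, b, rfl⟩

lemma Fac.zero : Fac (0 : X →ₗ[S] Y) := by
  have := Fac.mk' (0 : X →ₗ[S] S) (0 : S →ₗ[S] Y)
  simpa using this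

lemma Fac.add {f g : X →ₗ[S] Y} (hf : Fac f) (hg : Fac g) : Fac (f + g) := by
  obtain ⟨P, h1, h2, a, b, rfl⟩ := hf
  obtain ⟨Q, h3, h4, c, d, rfl⟩ := hg
  have := Fac.mk' (a.prod c) (b.coprod d)
  convert this using 1
  ext; simp

lemma Fac.neg {f : X →ₗ[S] Y} (hf : Fac f) : Fac (-f) := by
  obtain ⟨P, h1, h2, a, b, rfl⟩ := hf
  have := Fac.mk' a (-b)
  rwa [LinearMap.neg_comp] at this

lemma Fac.comp_left {f : X →ₗ[S] Y} (hf : Fac f) (g : Y →ₗ[S] Z) : Fac (g ∘ₗ f) := by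
  obtain ⟨P, h1, h2, a, b, rfl⟩ := hf
  exact Fac.mk' a (g ∘ₗ b)

lemma Fac.comp_right {f : Y →ₗ[S] Z} (hf : Fac f) (g : X →ₗ[S] Y) : Fac (f ∘ₗ g) := by
  obtain ⟨P, h1, h2, a, b, rfl⟩ := hf
  exact Fac.mk' (a ∘ₗ g) b

lemma Fac.smul {f : X →ₗ[S] Y} (hf : Fac f) (s : S) : Fac (s • f) := by
  obtain ⟨P, h1, h2, a, b, rfl⟩ := hf
  have := Fac.mk' a (s • b)
  rwa [LinearMap.smul_comp] at this

lemma Fac.sum {ι : Type} (t : Finset ι) (f : ι → X →ₗ[S] Y) (h : ∀ i ∈ t, Fac (f i)) :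
    Fac (∑ i ∈ t, f i) := by
  induction t using Finset.induction_on with
  | empty => simpa using Fac.zero
  | insert a s ha ih =>
    rw [Finset.sum_insert ha]
    exact (h a (by simp)).add (ih fun i hi => h i (by simp [hi]))
end FacL

/-- local triviality at `p` -/
def TP {S : Type} [CommRing S] (p : Ideal S) (N : Type) [AddCommGroup N] [Module S N] : Prop :=
  ∃ s ∉ p, Fac (s • (LinearMap.id : N →ₗ[S] N))

lemma mem_idealJ_iff (S : Type) [CommRing S] (m : ℕ) (M : Fin (m + 1) → ModuleCat.{0} S)
    (e0 : ↥(M 0) ≃ₗ[S] S) (s : S) :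
    s ∈ idealJ S m M ↔ Fac (s • (LinearMap.id : DirSum S m M →ₗ[S] DirSum S m M)) := by
  have h0 : s ∈ idealJ S m M ↔ (s • (LinearMap.id : DirSum S m M →ₗ[S] DirSum S m M) :
    Module.End S (DirSum S m M)) ∈ TwoSidedIdeal.span {idemZero S m M} := Iff.rfl
  rw [h0]
  constructor
  · intro h
    rw [TwoSidedIdeal.mem_span_iff_mem_addSubgroup_closure] at h
    refine AddSubgroup.closure_induction (p := fun f _ => Fac f) ?_ ?_ ?_ ?_ h
    · rintro x hx
      have he : Fac (idemZero S m M) := by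
        have := Fac.mk' (e0.toLinearMap ∘ₗ (LinearMap.proj 0 : DirSum S m M →ₗ[S] M 0))
          ((LinearMap.single S (fun i => ↥(M i)) 0) ∘ₗ e0.symm.toLinearMap)
        convert this using 1
        apply LinearMap.ext
        intro z
        simp [idemZero]
      obtain ⟨-, ⟨a, -, y, hy, rfl⟩, b, -, rfl⟩ := hx
      rw [Set.mem_singleton_iff] at hy
      subst hy
      exact (he.comp_left a).comp_right b
    · exact Fac.zero
    · intro x y _ _ hx hy; exact hx.add hy
    · intro x _ hx; exact hx.neg
  · rintro ⟨P, h1, h2, a, b, h⟩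
    let B := Module.Free.chooseBasis S P
    rw [← h]
    have : b ∘ₗ a = ∑ j, ((b ∘ₗ (LinearMap.toSpanSingleton S P (B j)) ∘ₗ e0.toLinearMap ∘ₗ
        LinearMap.proj 0 : Module.End S (DirSum S m M)) * (idemZero S m M) *
        ((LinearMap.single S (fun i => ↥(M i)) 0) ∘ₗ e0.symm.toLinearMap ∘ₗ (B.coord j) ∘ₗ a :
          Module.End S (DirSum S m M))) := by
      apply LinearMap.ext
      intro z
      rw [LinearMap.sum_apply]
      simp only [idemZero, Module.End.mul_apply, LinearMap.comp_apply]
      simp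
      conv_lhs => rw [← B.sum_repr (a z), map_sum]
      simp
    rw [this]
    refine sum_mem fun j _ => ?_
    exact TwoSidedIdeal.mul_mem_right _ _ _ (TwoSidedIdeal.mul_mem_left _ _ _
      (TwoSidedIdeal.subset_span rfl))

section Loc
variable {S : Type} [CommRing S] (W : Submonoid S) {N P : Type} [AddCommGroup N] [Module S N]
  [AddCommGroup P] [Module S P]

lemma locmap_comp {Q : Type} [AddCommGroup Q] [Module S Q] (b : P →ₗ[S] Q) (a : N →ₗ[S] P) :
    LocalizedModule.map W b ∘ₗ LocalizedModule.map W a = LocalizedModule.map W (b ∘ₗ a) := by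
  apply LinearMap.ext
  intro z
  induction z using LocalizedModule.induction_on with
  | h n t => simp [LocalizedModule.map_mk]

lemma locmap_id : LocalizedModule.map W (LinearMap.id : N →ₗ[S] N) = LinearMap.id := by
  apply LinearMap.ext
  intro z
  induction z using LocalizedModule.induction_on with
  | h n t => simp [LocalizedModule.map_mk]

lemma pdim_loc_of_fac {s : S} (hs : s ∈ W) (a : N →ₗ[S] P) (b : P →ₗ[S] N)
    (h : b ∘ₗ a = s • LinearMap.id) {n : ℕ}
    (hP : PDim (Localization W) (LocalizedModule W P) n) :
    PDim (Localization W) (LocalizedModule W N) n := by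
  refine hP.retract (LocalizedModule.map W a)
    ((IsLocalization.mk' (Localization W) 1 ⟨s, hs⟩ : Localization W) • LocalizedModule.map W b) ?_
  rw [LinearMap.smul_comp, locmap_comp, h, map_smul, locmap_id]
  rw [← algebraMap_smul (Localization W) s, smul_smul]
  rw [mul_comm, IsLocalization.mul_mk'_eq_mk'_of_mul, mul_one,
    IsLocalization.mk'_self, one_smul]

lemma TP_of_projective [IsNoetherianRing S] (p : Ideal S) [p.IsPrime] [Module.Finite S N]
    (h : Module.Projective (Localization p.primeCompl) (LocalizedModule p.primeCompl N)) :
    TP p N := by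
  have : Module.FinitePresentation S N := Module.finitePresentation_of_finite S N
  obtain ⟨k, f, hf⟩ := Module.Finite.exists_fin' S N
  let W := p.primeCompl
  have hfp : Function.Surjective (LocalizedModule.map W f) :=
    IsLocalizedModule.map_surjective W (LocalizedModule.mkLinearMap W _)
      (LocalizedModule.mkLinearMap W _) f hf
  obtain ⟨σ, hσ⟩ := Module.projective_lifting_property (LocalizedModule.map W f) LinearMap.id hfp
  obtain ⟨g, s, hg⟩ := Module.FinitePresentation.exists_lift_of_isLocalizedModule W
    (LocalizedModule.mkLinearMap W (Fin k → S))
    ((σ.restrictScalars S) ∘ₗ LocalizedModule.mkLinearMap W N)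
  obtain ⟨t, ht⟩ := Module.Finite.exists_smul_of_comp_eq_of_isLocalizedModule W
    (LocalizedModule.mkLinearMap W N) (f ∘ₗ g) (s • LinearMap.id) (by
      apply LinearMap.ext
      intro z
      have h1 := congrArg (LocalizedModule.map W f) (LinearMap.congr_fun hg z)
      have h2 : LocalizedModule.map W f (σ (LocalizedModule.mkLinearMap W N z)) =
        LocalizedModule.mkLinearMap W N z := LinearMap.congr_fun hσ _
      simp only [LinearMap.comp_apply, LinearMap.smul_apply, LinearMap.restrictScalars_apply] at h1
      have h3 : LocalizedModule.map W f (s • σ (LocalizedModule.mkLinearMap W N z)) =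
        s • LocalizedModule.mkLinearMap W N z := by
          refine Eq.trans ?_ (congrArg (fun w => s • w) h2)
          exact ((LocalizedModule.map W f).restrictScalars S).map_smul (s : S) _
      rw [h3] at h1
      have h4 : LocalizedModule.map W f (LocalizedModule.mkLinearMap W (Fin k → S) (g z)) =
        LocalizedModule.mkLinearMap W N (f (g z)) := by
          simp [LocalizedModule.map_mk]
      rw [h4] at h1
      simp only [LinearMap.comp_apply, LinearMap.smul_apply, LinearMap.id_apply]
      rw [h1]
      exact ((LocalizedModule.mkLinearMap W N).map_smul (s : S) z).symm)
  refine ⟨(t : S) * s, (t * s).2, ?_⟩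
  have : ((t : S) * s) • (LinearMap.id : N →ₗ[S] N) = (t : S) • (f ∘ₗ g) := by
    rw [mul_smul]; exact ht.symm
  rw [this]
  exact (Fac.mk' g f).smul _

end Loc


section PartA
variable {S : Type} [CommRing S] (W : Submonoid S)

lemma pdim_loc_retract {N P : Type} [AddCommGroup N] [Module S N] [AddCommGroup P] [Module S P]
    (i : N →ₗ[S] P) (r : P →ₗ[S] N) (h : r ∘ₗ i = LinearMap.id) {n : ℕ}
    (hP : PDim (Localization W) (LocalizedModule W P) n) :
    PDim (Localization W) (LocalizedModule W N) n :=
  hP.retract (LocalizedModule.map W i) (LocalizedModule.map W r) (by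
    rw [locmap_comp, h, locmap_id])

lemma pdim_loc_succ {K P N : Type} [AddCommGroup N] [Module S N] [AddCommGroup P] [Module S P]
    [AddCommGroup K] [Module S K] (i : K →ₗ[S] P) (f : P →ₗ[S] N)
    (hi : Function.Injective i) (hf : Function.Surjective f) (hex : Function.Exact i f)
    (hP : PDim (Localization W) (LocalizedModule W P) 0) (n : ℕ) :
    PDim (Localization W) (LocalizedModule W N) (n + 1) ↔
    PDim (Localization W) (LocalizedModule W K) n := by
  have := PDim.zero_iff.mp hP
  exact PDim.succ_iff (LocalizedModule.map W i) (LocalizedModule.map W f)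
    (IsLocalizedModule.map_injective W (LocalizedModule.mkLinearMap W _)
      (LocalizedModule.mkLinearMap W _) i hi)
    (IsLocalizedModule.map_surjective W (LocalizedModule.mkLinearMap W _)
      (LocalizedModule.mkLinearMap W _) f hf)
    (LocalizedModule.map_exact W i f hex) n

variable {N : Type} [AddCommGroup N] [Module S N]

lemma pdim_loc_free {s : S} (hs : s ∈ W) (hfac : Fac (s • (LinearMap.id : N →ₗ[S] N)))
    (I : Type) :
    PDim (Localization W) (LocalizedModule W (I →₀ Module.End S N)) 0 := by
  obtain ⟨P, h1, h2, α, β, h⟩ := hfac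
  let a : Module.End S N →ₗ[S] Module.End S P :=
    { toFun := fun f => α ∘ₗ f ∘ₗ β
      map_add' := by intro f g; simp [LinearMap.add_comp, LinearMap.comp_add]
      map_smul' := by intro c f; simp [LinearMap.smul_comp, LinearMap.comp_smul] }
  let b : Module.End S P →ₗ[S] Module.End S N :=
    { toFun := fun f => β ∘ₗ f ∘ₗ α
      map_add' := by intro f g; simp [LinearMap.add_comp, LinearMap.comp_add]
      map_smul' := by intro c f; simp [LinearMap.smul_comp, LinearMap.comp_smul] }
  have hba : ∀ f, b (a f) = (s * s) • f := by
    intro f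
    have h3 : ∀ z, β (α z) = s • z := fun z => LinearMap.congr_fun h z
    apply LinearMap.ext
    intro z
    simp [a, b, h3, mul_smul]
  refine pdim_loc_of_fac W (W.mul_mem hs hs) (P := I →₀ Module.End S P)
    (Finsupp.mapRange.linearMap a) (Finsupp.mapRange.linearMap b) ?_ ?_
  · apply LinearMap.ext
    intro z
    ext1 i
    simp [hba]
  · rw [PDim.zero_iff]
    infer_instance

lemma pdim_loc_mod {s : S} (hs : s ∈ W) (hfac : Fac (s • (LinearMap.id : N →ₗ[S] N))) (j : ℕ) :
    ∀ (Y : Type) [AddCommGroup Y] [Module (Module.End S N) Y] [Module S Y]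
      [IsScalarTower S (Module.End S N) Y],
      (∀ P : ModuleCat.{0} (Module.End S N), IsSyzygyIter (Module.End S N) j P
        (ModuleCat.of (Module.End S N) Y) → Module.Projective (Module.End S N) P) →
      PDim (Localization W) (LocalizedModule W Y) j := by
  induction j with
  | zero =>
    intro Y _ _ _ _ h
    have hY : Module.Projective (Module.End S N) Y := h (ModuleCat.of _ Y) ⟨LinearEquiv.refl _ _⟩
    obtain ⟨g, hg⟩ := Module.projective_def'.mp hY
    refine pdim_loc_retract W (g.restrictScalars S)
      ((Finsupp.linearCombination (Module.End S N) (id : Y → Y)).restrictScalars S) ?_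
      (pdim_loc_free W hs hfac Y)
    apply LinearMap.ext
    intro z
    exact LinearMap.congr_fun hg z
  | succ j ih =>
    intro Y _ _ _ _ h
    let f := Finsupp.linearCombination (Module.End S N) (id : Y → Y)
    have hf : Function.Surjective f := Finsupp.linearCombination_id_surjective _ _
    have hK := ih (LinearMap.ker f) (fun P hP => h P
      ⟨ModuleCat.of _ (LinearMap.ker f), ⟨Y, f, hf, ⟨LinearEquiv.refl _ _⟩⟩, hP⟩)
    exact (pdim_loc_succ W ((LinearMap.ker f).subtype.restrictScalars S) (f.restrictScalars S)
      (Submodule.injective_subtype _) hf (LinearMap.exact_subtype_ker_map f)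
      (pdim_loc_free W hs hfac Y) j).mpr hK

end PartA

lemma residue_equiv {S : Type} [CommRing S] (p : Ideal S) [hp : p.IsPrime] :
    Nonempty (IsLocalRing.ResidueField (Localization.AtPrime p) ≃ₗ[Localization.AtPrime p]
      LocalizedModule p.primeCompl (S ⧸ p)) := by
  let A := Localization.AtPrime p
  let L := LocalizedModule p.primeCompl (S ⧸ p)
  let z : L := LocalizedModule.mk 1 1
  let f : A →ₗ[A] L := LinearMap.toSpanSingleton A L z
  have hmk : ∀ (c : S) (t : p.primeCompl), f (Localization.mk c t) =
      LocalizedModule.mk (Ideal.Quotient.mk p c) t := by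
    intro c t
    change (Localization.mk c t : A) • (LocalizedModule.mk 1 1 : L) = _
    rw [LocalizedModule.mk_smul_mk, mul_one]
    congr 1
    rw [Algebra.smul_def, mul_one]; rfl
  have hf : Function.Surjective f := by
    intro y
    induction y using LocalizedModule.induction_on with
    | h q t =>
      obtain ⟨c, rfl⟩ := Ideal.Quotient.mk_surjective q
      exact ⟨_, hmk c t⟩
  have hker : LinearMap.ker f = IsLocalRing.maximalIdeal A := by
    have hle : IsLocalRing.maximalIdeal A ≤ LinearMap.ker f := by
      rw [← Localization.AtPrime.map_eq_maximalIdeal, Ideal.map_le_iff_le_comap]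
      intro c hc
      change f (algebraMap S A c) = 0
      rw [← Localization.mk_one_eq_algebraMap, hmk, Ideal.Quotient.eq_zero_iff_mem.mpr hc]
      exact LocalizedModule.zero_mk _
    have hne : LinearMap.ker f ≠ ⊤ := by
      intro h
      have h1 : (1 : A) ∈ LinearMap.ker f := by rw [h]; trivial
      rw [LinearMap.mem_ker, ← Localization.mk_one, hmk, ← LocalizedModule.zero_mk 1,
        LocalizedModule.mk_eq] at h1
      obtain ⟨u, hu⟩ := h1
      simp only [one_smul, smul_zero] at hu
      have h2 : Ideal.Quotient.mk p (u : S) = 0 := by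
        rw [← hu]
        change _ = (u : S) • (Ideal.Quotient.mk p 1 : S ⧸ p)
        rw [Algebra.smul_def, map_one, mul_one]; rfl
      exact u.2 (Ideal.Quotient.eq_zero_iff_mem.mp h2)
    exact ((IsLocalRing.maximalIdeal.isMaximal A).eq_of_le hne hle).symm
  exact ⟨(Submodule.quotEquivOfEq _ _ hker.symm).trans (LinearMap.quotKerEquivOfSurjective f hf)⟩

lemma partA {S : Type} [CommRing S] [IsNoetherianRing S] (p : Ideal S) [hp : p.IsPrime]
    {N : Type} [AddCommGroup N] [Module S N] (i0 : S →ₗ[S] N) (r0 : N →ₗ[S] S)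
    (hri : r0 ∘ₗ i0 = LinearMap.id) (hT : TP p N)
    (hgl : HasFiniteGlobalDim (Module.End S N)) :
    IsRegularLocalRing (Localization.AtPrime p) := by
  obtain ⟨s, hs, hfac⟩ := hT
  obtain ⟨d, hd⟩ := hgl
  let W := p.primeCompl
  let Q : Submodule (Module.End S N) N :=
    { carrier := (p • (⊤ : Submodule S N) : Submodule S N)
      add_mem' := fun ha hb => Submodule.add_mem _ ha hb
      zero_mem' := Submodule.zero_mem _
      smul_mem' := by
        intro f x hx
        have : (p • (⊤ : Submodule S N)).map f ≤ p • ⊤ := by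
          rw [Submodule.map_smul'']
          exact Submodule.smul_mono le_rfl le_top
        exact this ⟨x, hx, rfl⟩ }
  have hY := pdim_loc_mod W hs hfac d (N ⧸ Q) (fun P hP => hd _ P hP)
  let i : (S ⧸ p) →ₗ[S] (N ⧸ Q) := Submodule.liftQ p ((Q.mkQ.restrictScalars S) ∘ₗ i0) (by
    intro x hx
    rw [LinearMap.mem_ker]
    change Q.mkQ (i0 x) = 0
    rw [Submodule.mkQ_apply, Submodule.Quotient.mk_eq_zero]
    change i0 x ∈ p • (⊤ : Submodule S N)
    have : i0 x = x • i0 1 := by rw [← map_smul]; simp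
    rw [this]
    exact Submodule.smul_mem_smul hx trivial)
  let r : (N ⧸ Q) →ₗ[S] (S ⧸ p) :=
    (Submodule.mapQ (Q.restrictScalars S) p r0 (by
      intro x hx
      have h2 : (p • (⊤ : Submodule S N)).map r0 ≤ p := by
        rw [Submodule.map_smul'']
        exact Ideal.mul_le_left (I := p) (J := Submodule.map r0 ⊤)
      exact h2 ⟨x, hx, rfl⟩)) ∘ₗ (Submodule.Quotient.restrictScalarsEquiv S Q).symm.toLinearMap
  have hr : r ∘ₗ i = LinearMap.id := by
    apply LinearMap.ext
    intro z
    obtain ⟨c, rfl⟩ := Submodule.Quotient.mk_surjective _ z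
    change (Submodule.Quotient.mk (r0 (i0 c)) : S ⧸ p) = Submodule.Quotient.mk c
    rw [show r0 (i0 c) = c from LinearMap.congr_fun hri c]
  have h1 := pdim_loc_retract W i r hr hY
  obtain ⟨e⟩ := residue_equiv p
  exact serre (Localization.AtPrime p) d (h1.of_equiv e)


def EV (R : Type) [CommRing R] (M : Type) [AddCommGroup M] [Module R M] (n : ℕ) : Prop :=
  Subsingleton (Abelian.Ext (ModuleCat.of R M) (ModuleCat.of R R) n)

lemma ses_of {R : Type} [CommRing R] {A B C : Type} [AddCommGroup A] [Module R A]
    [AddCommGroup B] [Module R B] [AddCommGroup C] [Module R C]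
    (i : A →ₗ[R] B) (f : B →ₗ[R] C) (hi : Function.Injective i) (hf : Function.Surjective f)
    (hex : Function.Exact i f) :
    ∃ h : ModuleCat.ofHom i ≫ ModuleCat.ofHom f = 0,
      (ShortComplex.mk (ModuleCat.ofHom i) (ModuleCat.ofHom f) h).ShortExact := by
  refine ⟨?_, ?_⟩
  · rw [← ModuleCat.ofHom_comp, hex.linearMap_comp_eq_zero]; rfl
  · exact
      { exact := by
          rw [ShortComplex.ShortExact.moduleCat_exact_iff_function_exact]
          exact hex
        mono_f := (ModuleCat.mono_iff_injective _).mpr hi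
        epi_g := (ModuleCat.epi_iff_surjective _).mpr hf }

section
variable {R : Type} [CommRing R] {A B C : Type} [AddCommGroup A] [Module R A]
    [AddCommGroup B] [Module R B] [AddCommGroup C] [Module R C]

lemma EV.of_equiv (e : A ≃ₗ[R] B) {n : ℕ} (h : EV R B n) : EV R A n := by
  refine ⟨fun x y => ?_⟩
  have : Subsingleton (Abelian.Ext (ModuleCat.of R B) (ModuleCat.of R R) n) := h
  have key : ∀ x : Abelian.Ext (ModuleCat.of R A) (ModuleCat.of R R) n, x = 0 := by
    intro x
    have h1 : x = (Abelian.Ext.mk₀ (ModuleCat.ofHom e.toLinearMap)).comp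
        ((Abelian.Ext.mk₀ (ModuleCat.ofHom e.symm.toLinearMap)).comp x (zero_add n)) (zero_add n) := by
      rw [Abelian.Ext.mk₀_comp_mk₀_assoc, ← ModuleCat.ofHom_comp]
      have : e.symm.toLinearMap ∘ₗ e.toLinearMap = LinearMap.id := by ext; simp
      rw [this, ModuleCat.ofHom_id, Abelian.Ext.mk₀_id_comp]
    rw [h1, Subsingleton.elim ((Abelian.Ext.mk₀ (ModuleCat.ofHom e.symm.toLinearMap)).comp x (zero_add n)) 0,
      Abelian.Ext.comp_zero]
  rw [key x, key y]

lemma EV.mid (i : A →ₗ[R] B) (f : B →ₗ[R] C) (hi : Function.Injective i)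
    (hf : Function.Surjective f) (hex : Function.Exact i f) {n : ℕ}
    (hA : EV R A n) (hC : EV R C n) : EV R B n := by
  obtain ⟨h0, hS⟩ := ses_of i f hi hf hex
  have : Subsingleton (Abelian.Ext (ModuleCat.of R A) (ModuleCat.of R R) n) := hA
  have : Subsingleton (Abelian.Ext (ModuleCat.of R C) (ModuleCat.of R R) n) := hC
  refine subsingleton_of_forall_eq 0 (fun x => ?_)
  obtain ⟨y, hy⟩ := Abelian.Ext.contravariant_sequence_exact₂ hS _ x
    (Subsingleton.elim (α := Abelian.Ext (ModuleCat.of R A) (ModuleCat.of R R) n) _ _)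
  rw [← hy, Subsingleton.elim (α := Abelian.Ext (ModuleCat.of R C) (ModuleCat.of R R) n) y 0, Abelian.Ext.comp_zero]

lemma EV.left (i : A →ₗ[R] B) (f : B →ₗ[R] C) (hi : Function.Injective i)
    (hf : Function.Surjective f) (hex : Function.Exact i f) {n : ℕ}
    (hB : EV R B n) (hC : EV R C (n + 1)) : EV R A n := by
  obtain ⟨h0, hS⟩ := ses_of i f hi hf hex
  have : Subsingleton (Abelian.Ext (ModuleCat.of R B) (ModuleCat.of R R) n) := hB
  have : Subsingleton (Abelian.Ext (ModuleCat.of R C) (ModuleCat.of R R) (n+1)) := hC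
  refine subsingleton_of_forall_eq 0 (fun x => ?_)
  obtain ⟨y, hy⟩ := Abelian.Ext.contravariant_sequence_exact₁ hS _ x (add_comm 1 n)
    (Subsingleton.elim (α := Abelian.Ext (ModuleCat.of R C) (ModuleCat.of R R) (n+1)) _ _)
  rw [← hy, Subsingleton.elim (α := Abelian.Ext (ModuleCat.of R B) (ModuleCat.of R R) n) y 0, Abelian.Ext.comp_zero]

lemma EV.of_projective [Module.Projective R A] (n : ℕ) : EV R A (n + 1) := by
  have : Projective (ModuleCat.of R A) := (IsProjective.iff_projective A).mp inferInstance
  exact Abelian.Ext.subsingleton_of_projective _ _ _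

lemma EV.of_subsingleton [Subsingleton A] (n : ℕ) : EV R A n := by
  refine subsingleton_of_forall_eq 0 (fun x => ?_)
  have h1 : x = (Abelian.Ext.mk₀ (𝟙 (ModuleCat.of R A))).comp x (zero_add n) := by
    rw [Abelian.Ext.mk₀_id_comp]
  have h2 : 𝟙 (ModuleCat.of R A) = 0 := by
    ext y; exact Subsingleton.elim (α := A) _ _
  rw [h1, h2, Abelian.Ext.mk₀_zero, Abelian.Ext.zero_comp]

lemma EV.extend (i : A →ₗ[R] B) (f : B →ₗ[R] C) (hi : Function.Injective i)
    (hf : Function.Surjective f) (hex : Function.Exact i f)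
    (hC : EV R C 1) (g : A →ₗ[R] R) : ∃ g' : B →ₗ[R] R, g' ∘ₗ i = g := by
  obtain ⟨h0, hS⟩ := ses_of i f hi hf hex
  have : Subsingleton (Abelian.Ext (ModuleCat.of R C) (ModuleCat.of R R) 1) := hC
  obtain ⟨y, hy⟩ := Abelian.Ext.contravariant_sequence_exact₁ hS _
    (Abelian.Ext.mk₀ (ModuleCat.ofHom g)) (add_zero 1)
    (Subsingleton.elim (α := Abelian.Ext (ModuleCat.of R C) (ModuleCat.of R R) 1) _ _)
  obtain ⟨g', rfl⟩ := Abelian.Ext.addEquiv₀.symm.surjective y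
  refine ⟨g'.hom, ?_⟩
  have h2 : ModuleCat.ofHom i ≫ g' = ModuleCat.ofHom g := by
    apply Abelian.Ext.addEquiv₀.symm.injective
    simp only [Abelian.Ext.addEquiv₀_symm_apply] at hy ⊢
    rw [← hy, Abelian.Ext.mk₀_comp_mk₀]
  have := congrArg ModuleCat.Hom.hom h2
  simpa using this

lemma EV.smul [IsLocalRing R] [IsNoetherianRing R] [Module.Finite R A] {x : R}
    (hx : x ∈ IsLocalRing.maximalIdeal R) (hreg : IsSMulRegular A x) {n : ℕ}
    (h : EV R (QuotSMulTop x A) (n + 1)) : EV R A n := by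
  have hS := IsSMulRegular.smulShortComplex_shortExact (M := ModuleCat.of R A) hreg
  have h3 : ∀ y : Abelian.Ext (ModuleCat.of R A) (ModuleCat.of R R) n,
      (Abelian.Ext.mk₀ (x • 𝟙 (ModuleCat.of R A))).comp y (zero_add n) = x • y := by
    intro y
    rw [Abelian.Ext.mk₀_smul, Abelian.Ext.smul_comp, Abelian.Ext.mk₀_id_comp]
  have h1 : ∀ a : Abelian.Ext (ModuleCat.of R A) (ModuleCat.of R R) n, ∃ b, x • b = a := by
    intro a
    obtain ⟨y, hy⟩ := Abelian.Ext.contravariant_sequence_exact₁ hS _ a (add_comm 1 n)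
      (Subsingleton.elim (h := h) _ _)
    exact ⟨y, (h3 y).symm.trans hy⟩
  have h2 : (⊤ : Submodule R (Abelian.Ext (ModuleCat.of R A) (ModuleCat.of R R) n)) = ⊥ := by
    apply Submodule.eq_bot_of_le_smul_of_le_jacobson_bot (Ideal.span {x}) ⊤
    · exact Module.Finite.fg_top
    · intro a _
      obtain ⟨b, rfl⟩ := h1 a
      exact Submodule.smul_mem_smul (Ideal.mem_span_singleton_self x) trivial
    · rw [IsLocalRing.jacobson_eq_maximalIdeal _ bot_ne_top, Ideal.span_singleton_le_iff_mem]
      exact hx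
  exact (Submodule.subsingleton_iff R).mp ⟨fun a b => by
    rw [eq_bot_iff.mpr (le_top.trans h2.le : a ≤ ⊥), eq_bot_iff.mpr (le_top.trans h2.le : b ≤ ⊥)]⟩

end

lemma ev_bridge (R : Type) [CommRing R] (M : Type) [AddCommGroup M] [Module R M] (n : ℕ)
    (h : Subsingleton (((Ext R (ModuleCat.{0} R) (n + 1)).obj
          (Opposite.op (ModuleCat.of R M))).obj (ModuleCat.of R R))) : EV R M (n + 1) := by
  let P := projectiveResolution (ModuleCat.of R M)
  have h1 : Limits.IsZero ((P.complex.linearYonedaObj R (ModuleCat.of R R)).homology (n + 1)) :=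
    Limits.IsZero.of_iso (ModuleCat.isZero_of_iff_subsingleton.mpr h) (P.isoExt (R := R) (n + 1) (ModuleCat.of R R)).symm
  rw [← HomologicalComplex.exactAt_iff_isZero_homology,
    HomologicalComplex.exactAt_iff' _ n (n + 1) (n + 2) (by simp) (by simp)] at h1
  rw [ShortComplex.moduleCat_exact_iff] at h1
  refine subsingleton_of_forall_eq 0 (fun x => ?_)
  obtain ⟨f, hf, rfl⟩ := P.extMk_surjective x (n + 2) rfl
  rw [P.extMk_eq_zero_iff f (n + 2) rfl hf n rfl]
  obtain ⟨g, hg⟩ := h1 f hf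
  exact ⟨g, hg⟩


lemma ev_all (R : Type) [CommRing R] [IsLocalRing R] [IsNoetherianRing R] (d : ℕ)
    (h : ∀ i, d < i → EV R (IsLocalRing.ResidueField R) i) :
    ∀ (I : Ideal R) (N : Type) [AddCommGroup N] [Module R N] [Module.Finite R N],
      I ≤ Module.annihilator R N → ∀ i, d < i → EV R N i := by
  intro I
  induction I using (IsWellFounded.wf (r := ((· > ·) : Ideal R → Ideal R → Prop))).induction with
  | _ I ih =>
  intro N _ _ hfin
  refine IsNoetherianRing.induction_on_isQuotientEquivQuotientPrime R hfin
    (motive := fun N _ _ _ => I ≤ Module.annihilator R N → ∀ i, d < i → EV R N i) ?_ ?_ ?_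
  · intro N _ _ _ _ _ i _
    exact EV.of_subsingleton i
  · intro N _ _ _ q e hI i hi
    have hann : Module.annihilator R N = q.1 := by
      rw [e.annihilator_eq, Ideal.annihilator_quotient]
    by_cases hq : q.1 = IsLocalRing.maximalIdeal R
    · refine EV.of_equiv (e.trans (Submodule.quotEquivOfEq _ _ hq)) (h i hi)
    · have hlt : q.1 < IsLocalRing.maximalIdeal R :=
        lt_of_le_of_ne (IsLocalRing.le_maximalIdeal q.2.ne_top) hq
      obtain ⟨x, hx, hxq⟩ := SetLike.exists_of_lt hlt
      have hreg : IsSMulRegular N x := by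
        rw [isSMulRegular_iff_right_eq_zero_of_smul]
        intro y hy
        apply e.injective
        rw [map_zero]
        have h1 : x • e y = 0 := by rw [← map_smul, hy, map_zero]
        obtain ⟨c, hc⟩ := Ideal.Quotient.mk_surjective (e y)
        rw [← hc] at h1 ⊢
        have h2 : Ideal.Quotient.mk q.1 (x * c) = 0 := h1
        rw [Ideal.Quotient.eq_zero_iff_mem] at h2 ⊢
        exact (q.2.mem_or_mem h2).resolve_left hxq
      refine EV.smul hx hreg (ih (q.1 ⊔ Ideal.span {x}) ?_ _ ?_ (i + 1) (by omega))
      · refine lt_of_le_of_lt (hI.trans hann.le) ?_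
        rw [left_lt_sup, Ideal.span_singleton_le_iff_mem]
        exact hxq
      · rw [sup_le_iff, Ideal.span_singleton_le_iff_mem]
        refine ⟨hann.ge.trans ?_, ?_⟩
        · exact LinearMap.annihilator_le_of_surjective (Submodule.mkQ _) (Submodule.mkQ_surjective _)
        · rw [Module.mem_annihilator]
          intro y
          obtain ⟨y, rfl⟩ := Submodule.mkQ_surjective _ y
          rw [← map_smul]
          simp only [Submodule.mkQ_apply, Submodule.Quotient.mk_eq_zero]
          exact Submodule.smul_mem_pointwise_smul _ _ _ trivial
  · intro N₁ _ _ _ N₂ _ _ _ N₃ _ _ _ f g hf hg hex h1 h3 hI i hi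
    exact EV.mid f g hf hg hex
      (h1 (hI.trans (LinearMap.annihilator_le_of_injective f hf)) i hi)
      (h3 (hI.trans (LinearMap.annihilator_le_of_surjective g hg)) i hi)

lemma ev_of_regular (R : Type) [CommRing R] [IsLocalRing R] [IsNoetherianRing R] (d : ℕ)
    (h : ∀ (N : Type) [AddCommGroup N] [Module R N] [Module.Finite R N], ∀ i, d < i → EV R N i)
    (rs : List R) : ∀ (N : Type) [AddCommGroup N] [Module R N] [Module.Finite R N],
    (∀ r ∈ rs, r ∈ IsLocalRing.maximalIdeal R) → RingTheory.Sequence.IsWeaklyRegular N rs →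
      ∀ i, d < i + rs.length → EV R N i := by
  induction rs with
  | nil => intro N _ _ _ _ _ i hi; exact h N i (by simpa using hi)
  | cons x rs ih =>
    intro N _ _ _ hm hreg i hi
    rw [RingTheory.Sequence.isWeaklyRegular_cons_iff] at hreg
    refine EV.smul (hm x (by simp)) hreg.1 (ih _ (fun r hr => hm r (by simp [hr])) hreg.2 (i + 1) ?_)
    simp only [List.length_cons] at hi
    omega

lemma ev_mcm (S : Type) [CommRing S] [IsNoetherianRing S] (hGor : IsGorenstein S)
    (N : Type) [AddCommGroup N] [Module S N] [Module.Finite S N] (hN : IsMCM S N)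
    (m : Ideal S) [hm : m.IsMaximal] (i : ℕ) :
    EV (Localization.AtPrime m) (LocalizedModule m.primeCompl N) (i + 1) := by
  let R := Localization.AtPrime m
  have : IsNoetherianRing R := IsLocalization.isNoetherianRing m.primeCompl R inferInstance
  obtain ⟨d, hd⟩ := exists_nat_dim R
  have h0 : ∀ i, d < i → EV R (IsLocalRing.ResidueField R) i := by
    intro i hi
    obtain ⟨j, rfl⟩ : ∃ j, i = j + 1 := ⟨i - 1, by omega⟩
    refine ev_bridge R _ j ((hGor ⟨m, hm.isPrime⟩ (j + 1)).1 ?_)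
    change ((j + 1 : ℕ) : WithBot ℕ∞) ≠ ringKrullDim R
    rw [hd]
    intro h
    have : j + 1 = d := by exact_mod_cast h
    omega
  have h1 : ∀ (N : Type) [AddCommGroup N] [Module R N] [Module.Finite R N], ∀ i, d < i → EV R N i :=
    fun N _ _ _ => ev_all R d h0 ⊥ N bot_le
  rcases hN with hN | hN
  · have : Subsingleton (LocalizedModule m.primeCompl N) := inferInstance
    exact EV.of_subsingleton _
  have h2 := hN m hm
  unfold moduleDepth at h2
  have hle : (d : WithBot ℕ∞) ≤ ringKrullDim S := by
    rw [← hd, IsLocalization.AtPrime.ringKrullDim_eq_height m R]; exact Ideal.height_le_ringKrullDim_of_ne_top hm.ne_top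
  split_ifs at h2 with h3
  · have h4 : (⊤ : Submodule R (LocalizedModule m.primeCompl N)) = ⊥ := by
      apply Submodule.eq_bot_of_le_smul_of_le_jacobson_bot (IsLocalRing.maximalIdeal R) ⊤
      · exact Module.Finite.fg_top
      · exact h3.ge
      · rw [IsLocalRing.jacobson_eq_maximalIdeal _ bot_ne_top]
    have : Subsingleton (LocalizedModule m.primeCompl N) :=
      (Submodule.subsingleton_iff R).mp ⟨fun a b => by
        rw [eq_bot_iff.mpr (le_top.trans h4.le : a ≤ ⊥), eq_bot_iff.mpr (le_top.trans h4.le : b ≤ ⊥)]⟩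
    exact EV.of_subsingleton _
  · rcases Nat.eq_zero_or_pos d with hd0 | hd0
    · exact h1 _ _ (by omega)
    have h5 : ((d - 1 : ℕ) : WithBot ℕ∞) < ringKrullDim S := by
      refine lt_of_lt_of_le ?_ hle
      exact_mod_cast (by omega : d - 1 < d)
    obtain ⟨b, ⟨rs, hrs, hreg, hbl⟩, hb⟩ := lt_sSup_iff.mp (lt_of_lt_of_eq h5 h2.symm)
    have hbl' : b = ((rs.length : ℕ) : WithBot ℕ∞) := hbl
    rw [hbl'] at hb
    have h6 : d - 1 < rs.length := by exact_mod_cast hb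
    exact ev_of_regular R d h1 rs _ hrs hreg.toIsWeaklyRegular _ (by omega)


lemma ext_one {S : Type} [CommRing S] (W : Submonoid S) {K F N : Type}
    [AddCommGroup K] [Module S K] [AddCommGroup F] [Module S F] [AddCommGroup N] [Module S N]
    [Module.Finite S K] [Module.FinitePresentation S F]
    (i : K →ₗ[S] F) (f : F →ₗ[S] N) (hi : Function.Injective i) (hf : Function.Surjective f)
    (hex : Function.Exact i f) (hN : EV (Localization W) (LocalizedModule W N) 1)
    (g : K →ₗ[S] S) : ∃ u ∈ W, ∃ g' : F →ₗ[S] S, g' ∘ₗ i = u • g := by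
  let A := Localization W
  let gm : LocalizedModule W K →ₗ[A] A := IsLocalizedModule.mapExtendScalars W
    (LocalizedModule.mkLinearMap W K) (Algebra.linearMap S A) A g
  obtain ⟨G, hG⟩ := EV.extend (LocalizedModule.map W i) (LocalizedModule.map W f)
    (IsLocalizedModule.map_injective W (LocalizedModule.mkLinearMap W _)
      (LocalizedModule.mkLinearMap W _) i hi)
    (IsLocalizedModule.map_surjective W (LocalizedModule.mkLinearMap W _)
      (LocalizedModule.mkLinearMap W _) f hf)
    (LocalizedModule.map_exact W i f hex) hN gm
  obtain ⟨h, s, hs⟩ := Module.FinitePresentation.exists_lift_of_isLocalizedModule W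
    (Algebra.linearMap S A) ((G.restrictScalars S) ∘ₗ LocalizedModule.mkLinearMap W F)
  obtain ⟨t, ht⟩ := Module.Finite.exists_smul_of_comp_eq_of_isLocalizedModule W
    (Algebra.linearMap S A) (h ∘ₗ i) ((s : S) • g) (by
      apply LinearMap.ext
      intro x
      have h1 : Algebra.linearMap S A (h (i x)) = s • G (LocalizedModule.mkLinearMap W F (i x)) :=
        LinearMap.congr_fun hs (i x)
      have h2 : LocalizedModule.mkLinearMap W F (i x) = LocalizedModule.map W i (LocalizedModule.mkLinearMap W K x) := by
        simp [LocalizedModule.mkLinearMap_apply, LocalizedModule.map_mk]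
      have h3 : G (LocalizedModule.map W i (LocalizedModule.mkLinearMap W K x)) =
          gm (LocalizedModule.mkLinearMap W K x) := LinearMap.congr_fun hG _
      have h4 : gm (LocalizedModule.mkLinearMap W K x) = Algebra.linearMap S A (g x) :=
        IsLocalizedModule.map_apply W (LocalizedModule.mkLinearMap W K) (Algebra.linearMap S A) g x
      rw [LinearMap.comp_apply, LinearMap.comp_apply, h1, h2, h3, h4, LinearMap.comp_apply,
        LinearMap.smul_apply, map_smul]
      rfl)
  refine ⟨t * s, W.mul_mem t.2 s.2, (t : S) • h, ?_⟩
  rw [LinearMap.smul_comp, mul_smul]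
  exact ht

lemma ext_free {S : Type} [CommRing S] (W : Submonoid S) {K F N P : Type}
    [AddCommGroup K] [Module S K] [AddCommGroup F] [Module S F] [AddCommGroup N] [Module S N]
    [AddCommGroup P] [Module S P] [Module.Finite S P] [Module.Free S P]
    [Module.Finite S K] [Module.FinitePresentation S F]
    (i : K →ₗ[S] F) (f : F →ₗ[S] N) (hi : Function.Injective i) (hf : Function.Surjective f)
    (hex : Function.Exact i f) (hN : EV (Localization W) (LocalizedModule W N) 1)
    (a : K →ₗ[S] P) : ∃ u ∈ W, ∃ a' : F →ₗ[S] P, a' ∘ₗ i = u • a := by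
  let B := Module.Free.chooseBasis S P
  choose u hu g hg using fun j => ext_one W i f hi hf hex hN (B.coord j ∘ₗ a)
  refine ⟨∏ j, u j, Submonoid.prod_mem _ (fun j _ => hu j),
    ∑ j, (LinearMap.toSpanSingleton S P (B j)) ∘ₗ ((∏ l ∈ Finset.univ.erase j, u l) • g j), ?_⟩
  apply LinearMap.ext
  intro x
  have h1 : ∀ j, g j (i x) = u j • B.coord j (a x) := fun j => LinearMap.congr_fun (hg j) x
  simp only [LinearMap.comp_apply, LinearMap.sum_apply, LinearMap.smul_apply, h1,
    LinearMap.toSpanSingleton_apply, smul_smul]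
  simp only [smul_eq_mul, ← mul_assoc]
  conv_rhs => rw [← B.sum_repr (a x), Finset.smul_sum]
  refine Finset.sum_congr rfl (fun j _ => ?_)
  rw [Finset.prod_erase_mul _ _ (Finset.mem_univ j), smul_smul]
  rfl

lemma partB {S : Type} [CommRing S] [IsNoetherianRing S] (p m : Ideal S) [p.IsPrime] [m.IsPrime]
    (hpm : p ≤ m) (n : ℕ) : ∀ (N : Type) [AddCommGroup N] [Module S N] [Module.Finite S N],
    (∀ i, EV (Localization m.primeCompl) (LocalizedModule m.primeCompl N) (i + 1)) →
    PDim (Localization p.primeCompl) (LocalizedModule p.primeCompl N) n → TP p N := by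
  induction n with
  | zero =>
    intro N _ _ _ _ h
    exact TP_of_projective p (PDim.zero_iff.mp h)
  | succ n ih =>
    intro N _ _ _ hE hP
    obtain ⟨k, f, hf⟩ := Module.Finite.exists_fin' S N
    let K := LinearMap.ker f
    let i : K →ₗ[S] (Fin k → S) := K.subtype
    have hi : Function.Injective i := K.injective_subtype
    have hex : Function.Exact i f := LinearMap.exact_subtype_ker_map f
    have hK1 : ∀ j, EV (Localization m.primeCompl) (LocalizedModule m.primeCompl K) (j + 1) := by
      intro j
      exact EV.left (LocalizedModule.map m.primeCompl i) (LocalizedModule.map m.primeCompl f)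
        (IsLocalizedModule.map_injective m.primeCompl (LocalizedModule.mkLinearMap m.primeCompl _)
          (LocalizedModule.mkLinearMap m.primeCompl _) i hi)
        (IsLocalizedModule.map_surjective m.primeCompl (LocalizedModule.mkLinearMap m.primeCompl _)
          (LocalizedModule.mkLinearMap m.primeCompl _) f hf)
        (LocalizedModule.map_exact m.primeCompl i f hex) (EV.of_projective j) (hE (j + 1))
    have hK2 : PDim (Localization p.primeCompl) (LocalizedModule p.primeCompl K) n :=
      (pdim_loc_succ p.primeCompl i f hi hf hex (PDim.zero_iff.mpr inferInstance) n).mp hP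
    obtain ⟨s, hs, P, h1, h2, a, b, hab⟩ := ih K hK1 hK2
    obtain ⟨u, hu, a', ha'⟩ := ext_free m.primeCompl i f hi hf hex (hE 0) a
    let h : (Fin k → S) →ₗ[S] (Fin k → S) := (u * s) • LinearMap.id - i ∘ₗ b ∘ₗ a'
    have hh : K ≤ LinearMap.ker h := by
      intro x hx
      rw [LinearMap.mem_ker]
      have e1 : a' x = u • a ⟨x, hx⟩ := LinearMap.congr_fun ha' ⟨x, hx⟩
      have e2 : b (a ⟨x, hx⟩) = s • ⟨x, hx⟩ := LinearMap.congr_fun hab ⟨x, hx⟩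
      simp only [h, LinearMap.sub_apply, LinearMap.smul_apply, LinearMap.id_apply,
        LinearMap.comp_apply, e1, map_smul, e2, mul_smul]
      exact sub_self _
    let h' : N →ₗ[S] (Fin k → S) :=
      (K.liftQ h hh) ∘ₗ (LinearMap.quotKerEquivOfSurjective f hf).symm.toLinearMap
    have e3 : ∀ x, h' (f x) = h x := by
      intro x
      have : (LinearMap.quotKerEquivOfSurjective f hf).symm (f x) = Submodule.Quotient.mk x := by
        rw [LinearEquiv.symm_apply_eq]; rfl
      simp only [h', LinearMap.comp_apply, LinearEquiv.coe_coe, this]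
      rfl
    refine ⟨u * s, fun hus => ?_, ?_⟩
    · rcases Ideal.IsPrime.mem_or_mem ‹p.IsPrime› hus with h3 | h3
      · exact hu (hpm h3)
      · exact hs h3
    · have : (u * s) • (LinearMap.id : N →ₗ[S] N) = f ∘ₗ h' := by
        apply LinearMap.ext
        intro y
        obtain ⟨x, rfl⟩ := hf y
        rw [LinearMap.comp_apply, e3]
        have e4 : f (i (b (a' x))) = 0 := hex.apply_apply_eq_zero _
        simp [h, e4]
      rw [this]
      exact Fac.mk' h' f

lemma TP_pi {S : Type} [CommRing S] (p : Ideal S) [p.IsPrime] {n : ℕ} (M : Fin n → Type)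
    [∀ i, AddCommGroup (M i)] [∀ i, Module S (M i)] (h : ∀ i, TP p (M i)) :
    TP p (∀ i, M i) := by
  choose s hs hF using h
  refine ⟨∏ i, s i, ?_, ?_⟩
  · have : ∏ i, s i ∈ p.primeCompl := Submonoid.prod_mem _ (fun j _ => hs j)
    exact this
  · have : (∏ i, s i) • (LinearMap.id : (∀ i, M i) →ₗ[S] _) =
        ∑ j, (∏ l ∈ Finset.univ.erase j, s l) •
          (LinearMap.single S M j ∘ₗ (s j • LinearMap.id) ∘ₗ LinearMap.proj j) := by
      apply LinearMap.ext
      intro x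
      simp only [LinearMap.sum_apply, LinearMap.smul_apply, LinearMap.comp_apply, map_smul,
        smul_smul, Finset.prod_erase_mul _ _ (Finset.mem_univ _), LinearMap.id_apply]
      rw [← Finset.smul_sum]
      congr 1
      funext j
      simp [LinearMap.single_apply, Finset.sum_apply, Finset.sum_pi_single]
    rw [this]
    exact Fac.sum _ _ (fun j _ => (((hF j).comp_right _).comp_left _).smul _)

/-- **Statement 5.** Let `S` be a Gorenstein normal domain over `k` and let
`Λ = End_S(⊕_{i=0}^m M_i)` be a non-commutative resolution of `S`, where `M_0 = S` and the
`M_i` are indecomposable Cohen-Macaulay `S`-modules.  Let `φ : S ↪ Λ` be the canonical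
algebra injection given by the `S`-module structure, and `e ∈ Λ` the idempotent of the
summand `S`.  Then `Sing(Spec S) = Spec(φ(S)/(φ(S) ∩ ΛeΛ))` as subschemes of `Spec S`:
the singular locus coincides with the closed subscheme cut out by the ideal
`φ(S) ∩ ΛeΛ` of `S`. -/
theorem statement_5 (k : Type) [Field k] [IsAlgClosed k] [CharZero k]
    (S : Type) [CommRing S] [Algebra k S] [IsNoetherianRing S]
    (hdom : IsDomain S) (hnormal : IsIntegrallyClosed S) (hGor : IsGorenstein S)
    (m : ℕ) (M : Fin (m + 1) → ModuleCat.{0} S)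
    (e0 : ↥(M 0) ≃ₗ[S] S)
    (hfg : ∀ i, Module.Finite S ↥(M i)) (hCM : ∀ i, IsMCM S ↥(M i))
    (hind : ∀ i, IndecomposableMod S ↥(M i))
    (hrefl : Module.IsReflexive S (DirSum S m M))
    (hNCR : HasFiniteGlobalDim (Module.End S (DirSum S m M))) :
    PrimeSpectrum.zeroLocus (idealJ S m M : Set S) = singularSet S := by
  ext p
  have hmem : p ∈ PrimeSpectrum.zeroLocus (idealJ S m M : Set S) ↔
      ¬ TP p.asIdeal (DirSum S m M) := by
    rw [PrimeSpectrum.mem_zeroLocus]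
    constructor
    · rintro h ⟨s, hs, hf⟩
      exact hs (h ((mem_idealJ_iff S m M e0 s).mpr hf))
    · intro h s hs
      by_contra hsp
      exact h ⟨s, hsp, (mem_idealJ_iff S m M e0 s).mp hs⟩
  rw [hmem]
  change _ ↔ ¬ IsRegularLocal (Localization.AtPrime p.asIdeal)
  rw [not_iff_not, isRegularLocal_iff]
  constructor
  · intro hT
    refine partA p.asIdeal (N := DirSum S m M)
      ((LinearMap.single S (fun i => ↥(M i)) 0) ∘ₗ e0.symm.toLinearMap)
      (e0.toLinearMap ∘ₗ (LinearMap.proj 0 : DirSum S m M →ₗ[S] M 0)) ?_ hT hNCR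
    apply LinearMap.ext
    intro x
    simp
  · intro hreg
    obtain ⟨mm, hmm, hpm⟩ := Ideal.exists_le_maximal p.asIdeal p.2.ne_top
    refine TP_pi p.asIdeal (fun i => ↥(M i)) (fun i => ?_)
    have := hfg i
    obtain ⟨n, hn⟩ := reg_finite_pd (Localization.AtPrime p.asIdeal)
      (LocalizedModule p.asIdeal.primeCompl (M i))
    exact partB p.asIdeal mm hpm n (M i) (fun j => ev_mcm S hGor (M i) (hCM i) mm j) hn

end
end
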